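/- arXiv:1507.02967 — 13 statements merged into one kernel-verified Lean document; each statement's English description precedes it below -/
import Mathlib

section
/- Let V be a real inner product space and let u, v ∈ V be unit vectors. For a unit vector w let π_w denote the orthogonal projection x ↦ ⟨w,x⟩·w. Then the operator norm of π_v − π_u equals √(1 − ⟨u,v⟩²), and in particular ‖π_v − π_u‖ ≤ ‖v − u‖. Moreover the complementary projections π_w^⊥ := id − π_w satisfy ‖π_v^⊥ − π_u^⊥‖ = ‖π_v − π_u‖. -/
open RealInnerProductSpace

/-- For unit vectors `u, v` in a real inner product space, with
`π_w = (innerSL ℝ w).smulRight w` the orthogonal projection `x ↦ ⟪w,x⟫ • w`: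
`‖π_v − π_u‖ = √(1 − ⟪u,v⟫²)`, hence `‖π_v − π_u‖ ≤ ‖v − u‖`, and the complementary
projections `π_w^⊥ = id − π_w` satisfy `‖π_v^⊥ − π_u^⊥‖ = ‖π_v − π_u‖`. -/
theorem proj_diff_norm {V : Type*} [NormedAddCommGroup V] [InnerProductSpace ℝ V]
    (u v : V) (hu : ‖u‖ = 1) (hv : ‖v‖ = 1) :
    ‖(innerSL ℝ v).smulRight v - (innerSL ℝ u).smulRight u‖
        = Real.sqrt (1 - ⟪u, v⟫ ^ 2) ∧
    ‖(innerSL ℝ v).smulRight v - (innerSL ℝ u).smulRight u‖ ≤ ‖v - u‖ ∧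
    ‖(ContinuousLinearMap.id ℝ V - (innerSL ℝ v).smulRight v)
        - (ContinuousLinearMap.id ℝ V - (innerSL ℝ u).smulRight u)‖
      = ‖(innerSL ℝ v).smulRight v - (innerSL ℝ u).smulRight u‖ := by
  have huu : ⟪u, u⟫ = 1 := by rw [real_inner_self_eq_norm_sq, hu]; norm_num
  have hvv : ⟪v, v⟫ = 1 := by rw [real_inner_self_eq_norm_sq, hv]; norm_num
  have hvu : ⟪v, u⟫ = ⟪u, v⟫ := real_inner_comm _ _
  have key : ∀ x : V, ‖((innerSL ℝ v).smulRight v - (innerSL ℝ u).smulRight u) x‖ ^ 2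
      = ⟪v, x⟫ ^ 2 + ⟪u, x⟫ ^ 2 - 2 * ⟪v, x⟫ * ⟪u, x⟫ * ⟪u, v⟫ := by
    intro x
    rw [← real_inner_self_eq_norm_sq]
    simp only [ContinuousLinearMap.sub_apply, ContinuousLinearMap.smulRight_apply,
      innerSL_apply_apply, inner_sub_left, inner_sub_right, real_inner_smul_left,
      real_inner_smul_right, huu, hvv, hvu]
    ring
  have gram : ∀ x : V, ⟪v, x⟫ ^ 2 + ⟪u, x⟫ ^ 2 - 2 * ⟪v, x⟫ * ⟪u, x⟫ * ⟪u, v⟫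
      ≤ (1 - ⟪u, v⟫ ^ 2) * ‖x‖ ^ 2 := by
    intro x
    have h := real_inner_mul_inner_self_le (v - ⟪u, v⟫ • u) (x - ⟪u, x⟫ • u)
    have hxu : ⟪x, u⟫ = ⟪u, x⟫ := real_inner_comm _ _
    simp only [inner_sub_left, inner_sub_right, real_inner_smul_left,
      real_inner_smul_right, huu, hvv, hvu, hxu] at h
    rw [← real_inner_self_eq_norm_sq]
    nlinarith [h]
  have hc : 0 ≤ 1 - ⟪u, v⟫ ^ 2 := by
    have h := key u
    rw [huu, hvu] at h
    nlinarith [sq_nonneg ‖((innerSL ℝ v).smulRight v - (innerSL ℝ u).smulRight u) u‖]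
  have main : ‖(innerSL ℝ v).smulRight v - (innerSL ℝ u).smulRight u‖
      = Real.sqrt (1 - ⟪u, v⟫ ^ 2) := by
    apply le_antisymm
    · refine ContinuousLinearMap.opNorm_le_bound _ (Real.sqrt_nonneg _) fun x => ?_
      refine (sq_le_sq₀ (norm_nonneg _) (by positivity)).mp ?_
      rw [key, mul_pow, Real.sq_sqrt hc]
      exact gram x
    · have h := ((innerSL ℝ v).smulRight v - (innerSL ℝ u).smulRight u).le_opNorm u
      rw [hu, mul_one] at h
      refine le_trans (Real.sqrt_le_iff.mpr ⟨norm_nonneg _, ?_⟩) h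
      rw [key, huu, hvu]
      apply le_of_eq
      ring
  refine ⟨main, ?_, ?_⟩
  · rw [main, Real.sqrt_le_iff]
    refine ⟨norm_nonneg _, ?_⟩
    rw [norm_sub_sq_real, hu, hv, hvu]
    nlinarith [sq_nonneg (1 - ⟪u, v⟫)]
  · rw [sub_sub_sub_cancel_left, norm_sub_rev]
end

section
/- For all real numbers a, b, c ∈ [0,1] one has a·c + b·√(1−a²)·√(1−c²) ≤ √(a² ⊕ b²), where x ⊕ y := x + y − x·y. -/
/-- The operation `a ⊕ b := a + b − a·b` on `[0,1]`. -/
def oplus (x y : ℝ) : ℝ := x + y - x * y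

/-- For `a, b, c ∈ [0,1]`,
`a·c + b·√(1−a²)·√(1−c²) ≤ √(a² ⊕ b²)`. -/
theorem oplus_ineq (a b c : ℝ) (ha : a ∈ Set.Icc (0:ℝ) 1) (hb : b ∈ Set.Icc (0:ℝ) 1)
    (hc : c ∈ Set.Icc (0:ℝ) 1) :
    a * c + b * Real.sqrt (1 - a ^ 2) * Real.sqrt (1 - c ^ 2)
      ≤ Real.sqrt (oplus (a ^ 2) (b ^ 2)) := by
  have h1 : 0 ≤ 1 - a ^ 2 := by nlinarith [ha.1, ha.2]
  have h2 : 0 ≤ 1 - c ^ 2 := by nlinarith [hc.1, hc.2]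
  have hs := Real.sq_sqrt h1
  have ht := Real.sq_sqrt h2
  set s := Real.sqrt (1 - a ^ 2)
  set t := Real.sqrt (1 - c ^ 2)
  apply Real.le_sqrt_of_sq_le
  have key : oplus (a ^ 2) (b ^ 2) = (a ^ 2 + b ^ 2 * s ^ 2) * (c ^ 2 + t ^ 2) := by
    rw [hs, ht, oplus]; ring
  rw [key]
  nlinarith [sq_nonneg (a * t - b * s * c)]
end

section
/- Let V be a finite-dimensional real inner product space, let 0 ≤ κ < 1, let g be a nonzero linear map on V admitting a κ-gap most expanding direction v (a unit vector with ‖g v‖ = ‖g‖ and ‖g w‖ ≤ κ·‖g‖·‖w‖ for all w ⟂ v). Let w be a unit vector and set α := |⟨w,v⟩|. Then: (a) α·‖g‖ ≤ ‖g w‖ ≤ ‖g‖·√(α² ⊕ κ²); and (b) if α > 0 then g w ≠ 0 and δ(g w, g v) ≤ (κ/α)·√(1 − α²), i.e. δ(g w, g v) ≤ (κ/α)·δ(w, v). -/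
open RealInnerProductSpace

/-- `δ(p,q) = √(1 − ⟪p,q⟫²/(‖p‖²‖q‖²))`, the sine of the angle between the lines
spanned by `p` and `q`. -/
noncomputable def pdelta {V : Type*} [NormedAddCommGroup V] [InnerProductSpace ℝ V]
    (p q : V) : ℝ :=
  Real.sqrt (1 - ⟪p, q⟫ ^ 2 / (‖p‖ ^ 2 * ‖q‖ ^ 2))

/-- Expansion and contraction estimates for a linear map with a
`κ`-gap most expanding direction `v`. -/
theorem expansion_angle {V : Type*} [NormedAddCommGroup V] [InnerProductSpace ℝ V]
    [FiniteDimensional ℝ V]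
    (κ : ℝ) (hκ0 : 0 ≤ κ) (hκ1 : κ < 1)
    (g : V →L[ℝ] V) (hg : g ≠ 0)
    (v : V) (hv : ‖v‖ = 1) (hgv : ‖g v‖ = ‖g‖)
    (hgap : ∀ w : V, ⟪v, w⟫ = 0 → ‖g w‖ ≤ κ * ‖g‖ * ‖w‖)
    (w : V) (hw : ‖w‖ = 1) (α : ℝ) (hα : α = |⟪w, v⟫|) :
    (α * ‖g‖ ≤ ‖g w‖ ∧ ‖g w‖ ≤ ‖g‖ * Real.sqrt (oplus (α ^ 2) (κ ^ 2))) ∧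
    (0 < α → g w ≠ 0 ∧ pdelta (g w) (g v) ≤ (κ / α) * Real.sqrt (1 - α ^ 2)) := by
  have hG : 0 < ‖g‖ := norm_pos_iff.mpr hg
  obtain ⟨c, hc⟩ : ∃ c, c = ⟪w, v⟫ := ⟨_, rfl⟩
  obtain ⟨u, hu⟩ : ∃ u, u = w - c • v := ⟨_, rfl⟩
  have hvv : ⟪v, v⟫ = 1 := by rw [real_inner_self_eq_norm_sq, hv]; norm_num
  have hvu : ⟪v, u⟫ = 0 := by
    rw [hu, inner_sub_right, inner_smul_right, hvv, real_inner_comm, ← hc]; ring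
  have hwu : w = c • v + u := by rw [hu]; abel
  have key : ∀ (x y : V) (a b : ℝ), ‖a • x + b • y‖ ^ 2
      = a ^ 2 * ‖x‖ ^ 2 + 2 * (a * b) * ⟪x, y⟫ + b ^ 2 * ‖y‖ ^ 2 := by
    intro x y a b
    rw [norm_add_sq_real, norm_smul, norm_smul, inner_smul_left, inner_smul_right, mul_pow,
      mul_pow, Real.norm_eq_abs, Real.norm_eq_abs, sq_abs, sq_abs]
    simp only [conj_trivial]
    ring
  have hun : ‖u‖ ^ 2 = 1 - c ^ 2 := by
    have h := key v u c 1
    rw [one_smul, ← hwu, hw, hv, hvu] at h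
    linarith
  have hb : ⟪g v, g u⟫ = 0 := by
    obtain ⟨b, hb⟩ : ∃ b, b = ⟪g v, g u⟫ := ⟨_, rfl⟩
    rw [← hb]
    obtain ⟨C, hC⟩ : ∃ C, C = ‖g‖ ^ 2 * ‖u‖ ^ 2 := ⟨_, rfl⟩
    have hC0 : 0 ≤ C := by rw [hC]; positivity
    have ht : ∀ t : ℝ, 2 * t * b ≤ t ^ 2 * C := by
      intro t
      have h1 := key v u 1 t
      have h2 := key (g v) (g u) 1 t
      have h3 : ‖g ((1 : ℝ) • v + t • u)‖ ^ 2 ≤ (‖g‖ * ‖(1 : ℝ) • v + t • u‖) ^ 2 := by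
        gcongr
        exact g.le_opNorm _
      rw [mul_pow, h1, map_add, map_smul, map_smul, h2, ← hb, hvu, hv, hgv] at h3
      have : 0 ≤ t ^ 2 * ‖g u‖ ^ 2 := by positivity
      rw [hC]
      nlinarith
    have h := ht (b / (C + 1))
    have hC1 : 0 < C + 1 := by linarith
    have h4 : 2 * b ^ 2 * (C + 1) ≤ b ^ 2 * C := by
      have e1 : 2 * (b / (C + 1)) * b = (2 * b ^ 2 * (C + 1)) / (C + 1) ^ 2 := by field_simp
      have e2 : (b / (C + 1)) ^ 2 * C = (b ^ 2 * C) / (C + 1) ^ 2 := by field_simp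
      rw [e1, e2] at h
      exact (div_le_div_iff_of_pos_right (by positivity)).1 h
    have h5 : b ^ 2 ≤ 0 := by nlinarith [mul_nonneg (sq_nonneg b) hC0]
    exact pow_eq_zero_iff (two_ne_zero) |>.1 (le_antisymm h5 (sq_nonneg b))
  have hgu : ‖g u‖ ^ 2 ≤ κ ^ 2 * ‖g‖ ^ 2 * (1 - c ^ 2) := by
    rw [← hun, ← mul_pow, ← mul_pow]
    gcongr
    exact hgap u hvu
  have hgwe : g w = c • g v + (1 : ℝ) • g u := by
    conv_lhs => rw [hwu]
    rw [map_add, map_smul, one_smul]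
  have hgw : ‖g w‖ ^ 2 = c ^ 2 * ‖g‖ ^ 2 + ‖g u‖ ^ 2 := by
    rw [hgwe, key, hb, hgv]; ring
  have hip : ⟪g w, g v⟫ = c * ‖g‖ ^ 2 := by
    rw [hgwe, one_smul, inner_add_left, inner_smul_left, real_inner_comm (g v) (g u), hb,
      real_inner_self_eq_norm_sq, hgv]
    simp
  have hα0 : 0 ≤ α := by rw [hα]; positivity
  have hα2 : α ^ 2 = c ^ 2 := by rw [hα, sq_abs, hc]
  rw [← hα2] at hgw hgu hun
  have hlow : α * ‖g‖ ≤ ‖g w‖ := by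
    refine le_of_abs_le (abs_le_of_sq_le_sq ?_ (norm_nonneg _))
    rw [hgw, mul_pow]
    linarith [sq_nonneg ‖g u‖]
  refine ⟨⟨hlow, ?_⟩, ?_⟩
  · have h0 : 0 ≤ oplus (α ^ 2) (κ ^ 2) := by
      have : oplus (α ^ 2) (κ ^ 2) = α ^ 2 + κ ^ 2 * ‖u‖ ^ 2 := by
        rw [hun]; unfold oplus; ring
      rw [this]; positivity
    refine le_of_abs_le (abs_le_of_sq_le_sq ?_ (by positivity))
    rw [mul_pow, Real.sq_sqrt h0, hgw]
    unfold oplus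
    linarith
  · intro hpos
    have hgwpos : 0 < ‖g w‖ := lt_of_lt_of_le (by positivity) hlow
    refine ⟨norm_pos_iff.1 hgwpos, ?_⟩
    unfold pdelta
    have h1 : 0 ≤ 1 - α ^ 2 := by rw [← hun]; positivity
    apply Real.sqrt_le_iff.2 ⟨by positivity, ?_⟩
    rw [mul_pow, Real.sq_sqrt h1, hip, hgv]
    have e : 1 - (c * ‖g‖ ^ 2) ^ 2 / (‖g w‖ ^ 2 * ‖g‖ ^ 2) = ‖g u‖ ^ 2 / ‖g w‖ ^ 2 := by
      have : ‖g u‖ ^ 2 = ‖g w‖ ^ 2 - c ^ 2 * ‖g‖ ^ 2 := by rw [hgw, hα2]; ring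
      rw [this]
      field_simp
    rw [e]
    calc ‖g u‖ ^ 2 / ‖g w‖ ^ 2 ≤ (κ ^ 2 * ‖g‖ ^ 2 * (1 - α ^ 2)) / (α * ‖g‖) ^ 2 := by
          gcongr
      _ = (κ / α) ^ 2 * (1 - α ^ 2) := by field_simp
end

section
/- Let V be a finite-dimensional real inner product space, let 0 ≤ κ < 1 and 0 ≤ κ' < 1, and let g, g' be nonzero linear maps on V with κ-gap most expanding direction v (unit vector, ‖g v‖ = ‖g‖, ‖g w‖ ≤ κ‖g‖‖w‖ for w ⟂ v) and κ'-gap most expanding direction v' respectively. Set α := |⟨g v/‖g v‖, v'⟩|. Then α ≤ ‖g' ∘ g‖/(‖g'‖·‖g‖) ≤ √(κ² ⊕ α² ⊕ κ'²). -/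
open RealInnerProductSpace

theorem rb_orth {V : Type*} [NormedAddCommGroup V] [InnerProductSpace ℝ V]
    (g : V →L[ℝ] V) (v : V) (hv : ‖v‖ = 1) (hgv : ‖g v‖ = ‖g‖) (w : V)
    (hw : ⟪v, w⟫ = 0) : ⟪g v, g w⟫ = 0 := by
  have key : ∀ t : ℝ, 2 * t * ⟪g v, g w⟫ ≤ t ^ 2 * (‖g‖ ^ 2 * ‖w‖ ^ 2) := by
    intro t
    have h1 := g.le_opNorm (v + t • w)
    have h2 : ‖g (v + t • w)‖ ^ 2 ≤ ‖g‖ ^ 2 * ‖v + t • w‖ ^ 2 := by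
      rw [← mul_pow]; gcongr
    rw [map_add, map_smul, norm_add_sq_real, norm_add_sq_real, inner_smul_right,
      inner_smul_right, hw, hv, hgv, norm_smul, norm_smul, mul_pow, mul_pow,
      Real.norm_eq_abs, sq_abs] at h2
    nlinarith [mul_nonneg (sq_nonneg t) (sq_nonneg ‖g w‖)]
  set i := ⟪g v, g w⟫
  set K := ‖g‖ ^ 2 * ‖w‖ ^ 2
  have hK : 0 ≤ K := by positivity
  have h := key (i / (K + 1))
  have h3 : 2 * (i / (K + 1)) * i = 2 * (K + 1) * (i / (K + 1)) ^ 2 := by field_simp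
  rw [h3] at h
  have h4 : (i / (K + 1)) ^ 2 = 0 := by
    nlinarith [sq_nonneg (i / (K + 1)), mul_nonneg hK (sq_nonneg (i / (K + 1)))]
  have h5 : i / (K + 1) = 0 := by simpa using h4
  rcases div_eq_zero_iff.mp h5 with h | h
  · exact h
  · linarith

theorem rb_decomp {V : Type*} [NormedAddCommGroup V] [InnerProductSpace ℝ V]
    (g : V →L[ℝ] V) (v : V) (hv : ‖v‖ = 1) (hgv : ‖g v‖ = ‖g‖) (x : V) :
    ∃ w : V, x = ⟪v, x⟫ • v + w ∧ ⟪v, w⟫ = 0 ∧ ‖x‖ ^ 2 = ⟪v, x⟫ ^ 2 + ‖w‖ ^ 2 ∧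
      ‖g x‖ ^ 2 = ‖g‖ ^ 2 * ⟪v, x⟫ ^ 2 + ‖g w‖ ^ 2 := by
  have hw : ⟪v, x - ⟪v, x⟫ • v⟫ = 0 := by
    rw [inner_sub_right, inner_smul_right, real_inner_self_eq_norm_sq, hv]; ring
  obtain ⟨w, hwd⟩ : ∃ w, w = x - ⟪v, x⟫ • v := ⟨_, rfl⟩
  rw [← hwd] at hw
  have hx : x = ⟪v, x⟫ • v + w := by rw [hwd]; abel
  refine ⟨w, hx, hw, ?_, ?_⟩
  · have : ‖x‖ ^ 2 = ‖⟪v, x⟫ • v + w‖ ^ 2 := by rw [← hx]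
    rw [this, norm_add_sq_real, inner_smul_left, hw, norm_smul, hv, mul_pow,
      Real.norm_eq_abs, sq_abs]
    simp
  · have : ‖g x‖ ^ 2 = ‖g (⟪v, x⟫ • v + w)‖ ^ 2 := by rw [← hx]
    rw [this, map_add, map_smul, norm_add_sq_real, inner_smul_left,
      rb_orth g v hv hgv w hw, norm_smul, hgv, mul_pow, Real.norm_eq_abs, sq_abs]
    simp; ring

theorem rb_cs (A c q e M : ℝ) (he : 0 ≤ e) (hq : q ^ 2 ≤ e * M ^ 2) :
    (A * c + q) ^ 2 ≤ (A ^ 2 + M ^ 2) * (c ^ 2 + e) := by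
  have h : 2 * A * c * q ≤ A ^ 2 * e + M ^ 2 * c ^ 2 := by
    refine le_of_abs_le (abs_le_of_sq_le_sq ?_ (by positivity))
    have := mul_le_mul_of_nonneg_left hq (by positivity : 0 ≤ 4 * (A ^ 2 * c ^ 2))
    nlinarith [sq_nonneg (A ^ 2 * e - M ^ 2 * c ^ 2)]
  nlinarith

/-- For `g, g'` with `κ`- resp. `κ'`-gap most expanding directions `v, v'`,
and `α := |⟪g v/‖g v‖, v'⟫|`, one has `α ≤ ‖g' ∘ g‖/(‖g'‖·‖g‖) ≤ √(κ² ⊕ α² ⊕ κ'²)`. -/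
theorem rift_bounds {V : Type*} [NormedAddCommGroup V] [InnerProductSpace ℝ V]
    [FiniteDimensional ℝ V]
    (κ κ' : ℝ) (hκ0 : 0 ≤ κ) (hκ1 : κ < 1) (hκ'0 : 0 ≤ κ') (hκ'1 : κ' < 1)
    (g g' : V →L[ℝ] V) (hg : g ≠ 0) (hg' : g' ≠ 0)
    (v v' : V) (hv : ‖v‖ = 1) (hv' : ‖v'‖ = 1)
    (hgv : ‖g v‖ = ‖g‖) (hgv' : ‖g' v'‖ = ‖g'‖)
    (hgap : ∀ w : V, ⟪v, w⟫ = 0 → ‖g w‖ ≤ κ * ‖g‖ * ‖w‖)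
    (hgap' : ∀ w : V, ⟪v', w⟫ = 0 → ‖g' w‖ ≤ κ' * ‖g'‖ * ‖w‖)
    (α : ℝ) (hα : α = |⟪‖g v‖⁻¹ • (g v), v'⟫|) :
    α ≤ ‖g'.comp g‖ / (‖g'‖ * ‖g‖) ∧
    ‖g'.comp g‖ / (‖g'‖ * ‖g‖)
      ≤ Real.sqrt (oplus (oplus (κ ^ 2) (α ^ 2)) (κ' ^ 2)) := by
  have hG : 0 < ‖g‖ := norm_pos_iff.mpr hg
  have hG' : 0 < ‖g'‖ := norm_pos_iff.mpr hg'
  obtain ⟨u, hu⟩ : ∃ u, u = ‖g v‖⁻¹ • (g v) := ⟨_, rfl⟩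
  obtain ⟨c, hc⟩ : ∃ c : ℝ, c = ⟪v', u⟫ := ⟨_, rfl⟩
  have hgu : g v = ‖g‖ • u := by
    rw [hu, hgv, smul_smul, mul_inv_cancel₀ hG.ne', one_smul]
  have hu1 : ‖u‖ = 1 := by
    rw [hu, norm_smul, norm_inv, norm_norm, hgv, inv_mul_cancel₀ hG.ne']
  have hαc : α = |c| := by rw [hα, ← hu, hc, real_inner_comm]
  have hα2 : α ^ 2 = c ^ 2 := by rw [hαc, sq_abs]
  have hc1 : c ^ 2 ≤ 1 := by
    have := abs_real_inner_le_norm v' u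
    rw [← hc, hv', hu1] at this
    rw [← sq_abs]; nlinarith [abs_nonneg c]
  constructor
  · rw [le_div_iff₀ (by positivity)]
    have h1 := (g'.comp g).le_opNorm v
    rw [hv, mul_one, ContinuousLinearMap.comp_apply, hgu, map_smul, norm_smul, norm_norm] at h1
    obtain ⟨w, -, -, -, h2⟩ := rb_decomp g' v' hv' hgv' u
    rw [← hc] at h2
    have h3 : ‖g'‖ * α ≤ ‖g' u‖ := by
      refine le_of_abs_le (abs_le_of_sq_le_sq ?_ (norm_nonneg _))
      rw [mul_pow, hα2]; nlinarith [sq_nonneg ‖g' w‖]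
    nlinarith
  · have hs0 : 0 ≤ oplus (oplus (κ ^ 2) (α ^ 2)) (κ' ^ 2) := by
      have h1 : κ' ^ 2 ≤ 1 := by nlinarith
      unfold oplus; rw [hα2]
      nlinarith [mul_nonneg (sq_nonneg κ) (sub_nonneg.2 hc1), sq_nonneg c, sq_nonneg κ',
        mul_nonneg (add_nonneg (mul_nonneg (sq_nonneg κ) (sub_nonneg.2 hc1)) (sq_nonneg c))
          (sub_nonneg.2 h1)]
    rw [div_le_iff₀ (by positivity)]
    refine ContinuousLinearMap.opNorm_le_bound _ (by positivity) fun x => ?_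
    refine le_of_abs_le (abs_le_of_sq_le_sq ?_ (by positivity))
    rw [mul_pow, mul_pow, Real.sq_sqrt hs0, ContinuousLinearMap.comp_apply]
    obtain ⟨w, hx, hw, hxn, hgx⟩ := rb_decomp g v hv hgv x
    obtain ⟨z, -, hz, hyn, hgy⟩ := rb_decomp g' v' hv' hgv' (g x)
    obtain ⟨a, ha⟩ : ∃ a : ℝ, a = ⟪v, x⟫ := ⟨_, rfl⟩
    rw [← ha] at hx hxn hgx
    have hz2 : ‖g' z‖ ^ 2 ≤ κ' ^ 2 * ‖g'‖ ^ 2 * ‖z‖ ^ 2 := by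
      rw [← mul_pow, ← mul_pow]; gcongr; exact hgap' z hz
    have hw2 : ‖g w‖ ^ 2 ≤ κ ^ 2 * (‖g‖ * ‖w‖) ^ 2 := by
      rw [← mul_pow, ← mul_assoc]; gcongr; exact hgap w hw
    have hy2 : ‖g x‖ ^ 2 ≤ ‖g‖ ^ 2 * ‖x‖ ^ 2 := by
      rw [← mul_pow]; gcongr; exact g.le_opNorm x
    have huz : ⟪u, g w⟫ = 0 := by
      rw [hu, inner_smul_left, rb_orth g v hv hgv w hw, mul_zero]
    have hq : ⟪v', g w⟫ ^ 2 ≤ (1 - c ^ 2) * ‖g w‖ ^ 2 := by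
      have e1 : ⟪v', g w⟫ = ⟪v' - c • u, g w⟫ := by
        rw [inner_sub_left, inner_smul_left, huz]; simp
      have e2 : ‖v' - c • u‖ ^ 2 = 1 - c ^ 2 := by
        rw [norm_sub_sq_real, inner_smul_right, ← hc, norm_smul, hv', hu1, mul_pow,
          Real.norm_eq_abs, sq_abs]; ring
      rw [e1, ← e2, ← mul_pow, ← sq_abs]
      gcongr
      exact abs_real_inner_le_norm _ _
    have hp : ⟪v', g x⟫ = (a * ‖g‖) * c + ⟪v', g w⟫ := by
      conv_lhs => rw [hx]
      rw [map_add, map_smul, inner_add_right, inner_smul_right, hgu, inner_smul_right, ← hc]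
      ring
    have hp2 : ⟪v', g x⟫ ^ 2 ≤ ‖g‖ ^ 2 * ‖x‖ ^ 2 * (c ^ 2 + (1 - c ^ 2) * κ ^ 2) := by
      have := rb_cs (a * ‖g‖) c ⟪v', g w⟫ ((1 - c ^ 2) * κ ^ 2) (‖g‖ * ‖w‖)
        (mul_nonneg (sub_nonneg.2 hc1) (sq_nonneg κ)) (by
          refine hq.trans ?_
          rw [mul_assoc]
          exact mul_le_mul_of_nonneg_left hw2 (sub_nonneg.2 hc1))
      rw [hp, hxn]
      refine this.trans (le_of_eq ?_)
      ring
    have hk1 : 0 ≤ 1 - κ' ^ 2 := by nlinarith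
    have hfin : ‖g' (g x)‖ ^ 2 ≤
        ‖g'‖ ^ 2 * ((1 - κ' ^ 2) * ⟪v', g x⟫ ^ 2 + κ' ^ 2 * ‖g x‖ ^ 2) := by
      rw [hgy, hyn]; linarith
    refine hfin.trans ?_
    calc _ ≤ ‖g'‖ ^ 2 * ((1 - κ' ^ 2) * (‖g‖ ^ 2 * ‖x‖ ^ 2 * (c ^ 2 + (1 - c ^ 2) * κ ^ 2))
          + κ' ^ 2 * (‖g‖ ^ 2 * ‖x‖ ^ 2)) := by gcongr
      _ = _ := by unfold oplus; rw [hα2]; ring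
end

section
/- Let V be a finite-dimensional real inner product space, let 0 ≤ κ < 1 and 0 ≤ κ' < 1, and let g, g' be nonzero linear maps on V with κ-gap most expanding direction v and κ'-gap most expanding direction v' respectively. Set α := |⟨g v/‖g v‖, v'⟩| and ρ := ‖g' ∘ g‖/(‖g'‖·‖g‖). If κ² + κ'² ≤ ρ² then α ≥ ρ·√(1 − (κ² + κ'²)/ρ²). -/
open RealInnerProductSpace

lemma aux_orth {V : Type*} [NormedAddCommGroup V] [InnerProductSpace ℝ V]
    (g : V →L[ℝ] V) (v w : V) (hv : ‖v‖ = 1) (hgv : ‖g v‖ = ‖g‖) (hw : ⟪v, w⟫ = 0) :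
    ⟪g v, g w⟫ = 0 := by
  have key : ∀ t : ℝ, 2 * t * ⟪g v, g w⟫ ≤ t ^ 2 * (‖g‖ ^ 2 * ‖w‖ ^ 2) := by
    intro t
    have h1 : ‖g (v + t • w)‖ ^ 2 ≤ (‖g‖ * ‖v + t • w‖) ^ 2 :=
      pow_le_pow_left₀ (norm_nonneg _) (g.le_opNorm _) 2
    rw [mul_pow, map_add, map_smul, norm_add_sq_real, norm_add_sq_real, inner_smul_right,
      inner_smul_right, hw, norm_smul, norm_smul, mul_pow, mul_pow, Real.norm_eq_abs, sq_abs,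
      hgv, hv] at h1
    nlinarith [mul_nonneg (sq_nonneg t) (sq_nonneg ‖g w‖)]
  set c := ⟪g v, g w⟫
  set K := ‖g‖ ^ 2 * ‖w‖ ^ 2
  have hK : 0 ≤ K := by positivity
  have h2 := key (c / (K + 1))
  have hK1 : 0 < K + 1 := by linarith
  rw [div_pow, ← mul_div_assoc, div_mul_eq_mul_div, div_mul_eq_mul_div,
    div_le_div_iff₀ hK1 (by positivity)] at h2
  have h3 : 0 ≤ (K + 1) * (c ^ 2 * (-(K + 2))) := by nlinarith
  have h4 := nonneg_of_mul_nonneg_right h3 hK1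
  have h5 : c ^ 2 ≤ 0 := by nlinarith [sq_nonneg c, mul_nonneg hK (sq_nonneg c)]
  exact pow_eq_zero_iff (two_ne_zero) |>.1 (le_antisymm h5 (sq_nonneg c))

lemma aux_decomp {V : Type*} [NormedAddCommGroup V] [InnerProductSpace ℝ V]
    (v x : V) (hv : ‖v‖ = 1) :
    ∃ w : V, x = ⟪v, x⟫ • v + w ∧ ⟪v, w⟫ = 0 ∧ ‖x‖ ^ 2 = ⟪v, x⟫ ^ 2 + ‖w‖ ^ 2 := by
  have h0 : ⟪v, x - ⟪v, x⟫ • v⟫ = 0 := by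
    rw [inner_sub_right, inner_smul_right, real_inner_self_eq_norm_sq, hv]; ring
  refine ⟨x - ⟪v, x⟫ • v, by abel, h0, ?_⟩
  have h1 : x = ⟪v, x⟫ • v + (x - ⟪v, x⟫ • v) := by abel
  generalize x - ⟪v, x⟫ • v = w at *
  generalize ⟪v, x⟫ = a at *
  subst h1
  rw [norm_add_sq_real, inner_smul_left, h0, norm_smul, hv, Real.norm_eq_abs, mul_pow, sq_abs]
  ring

set_option maxHeartbeats 2000000 in
lemma aux_bound {V : Type*} [NormedAddCommGroup V] [InnerProductSpace ℝ V]
    (κ κ' : ℝ) (g g' : V →L[ℝ] V)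
    (v v' : V) (hv : ‖v‖ = 1) (hv' : ‖v'‖ = 1) (hgv' : ‖g' v'‖ = ‖g'‖)
    (hgap : ∀ w : V, ⟪v, w⟫ = 0 → ‖g w‖ ≤ κ * ‖g‖ * ‖w‖)
    (hgap' : ∀ w : V, ⟪v', w⟫ = 0 → ‖g' w‖ ≤ κ' * ‖g'‖ * ‖w‖)
    (α : ℝ) (hα : ⟪v', g v⟫ ^ 2 = α ^ 2 * ‖g‖ ^ 2) (x : V) :
    ‖g' (g x)‖ ^ 2 ≤ (α ^ 2 + κ ^ 2 + κ' ^ 2) * (‖g'‖ * ‖g‖ * ‖x‖) ^ 2 := by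
  obtain ⟨w, hx, hw, hxn⟩ := aux_decomp v x hv
  obtain ⟨z, hy, hz, hyn⟩ := aux_decomp v' (g x) hv'
  have ho := aux_orth g' v' z hv' hgv' hz
  have hc : ⟪v', g x⟫ = ⟪v, x⟫ * ⟪v', g v⟫ + ⟪v', g w⟫ := by
    conv_lhs => rw [hx]
    rw [map_add, map_smul, inner_add_right, inner_smul_right]
  have h1 : ⟪v', g w⟫ ^ 2 ≤ (κ * ‖g‖ * ‖w‖) ^ 2 := by
    apply sq_le_sq.2
    have := abs_real_inner_le_norm v' (g w)
    rw [hv', one_mul] at this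
    exact this.trans ((hgap w hw).trans (le_abs_self _))
  have h2 : ‖g' z‖ ^ 2 ≤ (κ' * ‖g'‖ * ‖z‖) ^ 2 :=
    pow_le_pow_left₀ (norm_nonneg _) (hgap' z hz) 2
  have h3 : ‖g x‖ ^ 2 ≤ (‖g‖ * ‖x‖) ^ 2 :=
    pow_le_pow_left₀ (norm_nonneg _) (g.le_opNorm _) 2
  have h4 : ‖g' (g x)‖ ^ 2 = ⟪v', g x⟫ ^ 2 * ‖g'‖ ^ 2 + ‖g' z‖ ^ 2 := by
    conv_lhs => rw [hy]
    rw [map_add, map_smul, norm_add_sq_real, inner_smul_left, ho, norm_smul, hgv',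
      Real.norm_eq_abs, mul_pow, sq_abs]
    ring
  have h5 : ⟪v', g x⟫ ^ 2 ≤ (α ^ 2 + κ ^ 2) * (‖g‖ * ‖x‖) ^ 2 := by
    have e : (α ^ 2 + κ ^ 2) * (‖g‖ * ‖x‖) ^ 2 =
        ⟪v, x⟫ ^ 2 * ⟪v', g v⟫ ^ 2 + ‖w‖ ^ 2 * ⟪v', g v⟫ ^ 2
          + ⟪v, x⟫ ^ 2 * (κ * ‖g‖) ^ 2 + (κ * ‖g‖ * ‖w‖) ^ 2 := by
      rw [hα, mul_pow, hxn]; ring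
    rw [hc, e]
    by_cases hw0 : ‖w‖ = 0
    · rw [hw0] at h1 ⊢
      have : ⟪v', g w⟫ = 0 := by
        rw [norm_eq_zero.1 hw0]; simp
      rw [this]
      nlinarith [sq_nonneg (⟪v, x⟫ * (κ * ‖g‖))]
    · obtain ⟨q, hq⟩ : ∃ q, ⟪v', g w⟫ = q * ‖w‖ := ⟨⟪v', g w⟫ / ‖w‖, by field_simp⟩
      rw [hq] at h1 ⊢
      have hwp : 0 < ‖w‖ ^ 2 := by positivity
      have h6 : q ^ 2 ≤ (κ * ‖g‖) ^ 2 := by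
        rw [mul_pow, mul_pow _ ‖w‖] at h1
        exact le_of_mul_le_mul_right h1 hwp
      nlinarith [sq_nonneg (‖w‖ * ⟪v', g v⟫ - ⟪v, x⟫ * q),
        mul_le_mul_of_nonneg_left h6 (sq_nonneg ⟪v, x⟫)]
  have h7 : ‖z‖ ^ 2 ≤ (‖g‖ * ‖x‖) ^ 2 := by nlinarith [sq_nonneg ⟪v', g x⟫]
  have h8 := mul_le_mul_of_nonneg_right h5 (sq_nonneg ‖g'‖)
  have h9 := mul_le_mul_of_nonneg_left h7 (sq_nonneg (κ' * ‖g'‖))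
  rw [h4]
  have e2 : (α ^ 2 + κ ^ 2 + κ' ^ 2) * (‖g'‖ * ‖g‖ * ‖x‖) ^ 2 =
      (α ^ 2 + κ ^ 2) * (‖g‖ * ‖x‖) ^ 2 * ‖g'‖ ^ 2 + (κ' * ‖g'‖) ^ 2 * (‖g‖ * ‖x‖) ^ 2 := by ring
  rw [mul_pow _ ‖z‖] at h2
  rw [e2]
  linarith

/-- Lower bound on the angle `α(g,g')` in terms of the expansion rift
`ρ = ‖g'∘g‖/(‖g'‖·‖g‖)`: if `κ² + κ'² ≤ ρ²` then `α ≥ ρ·√(1 − (κ² + κ'²)/ρ²)`. -/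
theorem angle_rift {V : Type*} [NormedAddCommGroup V] [InnerProductSpace ℝ V]
    [FiniteDimensional ℝ V]
    (κ κ' : ℝ) (hκ0 : 0 ≤ κ) (hκ1 : κ < 1) (hκ'0 : 0 ≤ κ') (hκ'1 : κ' < 1)
    (g g' : V →L[ℝ] V) (hg : g ≠ 0) (hg' : g' ≠ 0)
    (v v' : V) (hv : ‖v‖ = 1) (hv' : ‖v'‖ = 1)
    (hgv : ‖g v‖ = ‖g‖) (hgv' : ‖g' v'‖ = ‖g'‖)
    (hgap : ∀ w : V, ⟪v, w⟫ = 0 → ‖g w‖ ≤ κ * ‖g‖ * ‖w‖)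
    (hgap' : ∀ w : V, ⟪v', w⟫ = 0 → ‖g' w‖ ≤ κ' * ‖g'‖ * ‖w‖)
    (α ρ : ℝ) (hα : α = |⟪‖g v‖⁻¹ • (g v), v'⟫|)
    (hρ : ρ = ‖g'.comp g‖ / (‖g'‖ * ‖g‖))
    (h : κ ^ 2 + κ' ^ 2 ≤ ρ ^ 2) :
    ρ * Real.sqrt (1 - (κ ^ 2 + κ' ^ 2) / ρ ^ 2) ≤ α := by
  have hG : 0 < ‖g‖ := norm_pos_iff.2 hg
  have hG' : 0 < ‖g'‖ := norm_pos_iff.2 hg'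
  have hα0 : 0 ≤ α := hα ▸ abs_nonneg _
  have hρ0 : 0 ≤ ρ := by rw [hρ]; positivity
  have hα2 : ⟪v', g v⟫ ^ 2 = α ^ 2 * ‖g‖ ^ 2 := by
    rw [hα, sq_abs, real_inner_smul_left, real_inner_comm, hgv]
    field_simp
  have hb : ‖g'.comp g‖ ≤ Real.sqrt (α ^ 2 + κ ^ 2 + κ' ^ 2) * (‖g'‖ * ‖g‖) := by
    refine ContinuousLinearMap.opNorm_le_bound _ (by positivity) fun x => ?_
    refine (pow_le_pow_iff_left₀ (by positivity) (by positivity) two_ne_zero).1 ?_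
    have := aux_bound κ κ' g g' v v' hv hv' hgv' hgap hgap' α hα2 x
    rw [mul_assoc, mul_pow, Real.sq_sqrt (by positivity)]
    exact this
  have hρ1 : ρ ≤ Real.sqrt (α ^ 2 + κ ^ 2 + κ' ^ 2) := by
    rw [hρ]; exact (div_le_iff₀ (by positivity)).2 hb
  have hρ2 : ρ ^ 2 ≤ α ^ 2 + κ ^ 2 + κ' ^ 2 := (Real.le_sqrt hρ0 (by positivity)).1 hρ1
  rcases hρ0.eq_or_lt with h0 | h0
  · rw [← h0]; simpa using hα0
  · refine (pow_le_pow_iff_left₀ (by positivity) (by positivity) two_ne_zero).1 ?_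
    have hs : 0 ≤ 1 - (κ ^ 2 + κ' ^ 2) / ρ ^ 2 := by
      rw [sub_nonneg]; exact (div_le_one (by positivity)).2 h
    rw [mul_pow, Real.sq_sqrt hs, mul_sub, mul_div_cancel₀ _ (by positivity)]
    linarith
end

section
/- Let V be a finite-dimensional real inner product space and let g₀, g₁, …, g_{n−1} be nonzero linear maps on V. For 1 ≤ i ≤ n−1 set g^{(i)} := g_{i−1} ∘ ⋯ ∘ g₁ ∘ g₀ and assume g^{(i)} ≠ 0, that g_i admits a κ_i-gap most expanding direction v_i with 0 ≤ κ_i < 1, and that g^{(i)} admits a λ_i-gap most expanding direction u_i with 0 ≤ λ_i < 1. Set α_i := |⟨g^{(i)} u_i/‖g^{(i)} u_i‖, v_i⟩| and β_i := √(λ_i² ⊕ α_i² ⊕ κ_i²). Then ∏_{i=1}^{n−1} α_i ≤ ‖g_{n−1} ⋯ g₁ g₀‖ / (‖g_{n−1}‖ ⋯ ‖g₁‖·‖g₀‖) ≤ ∏_{i=1}^{n−1} β_i. -/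
open RealInnerProductSpace

/-- `chainProd g i = g_{i-1} ∘ ⋯ ∘ g₁ ∘ g₀` (and `chainProd g 0 = id`). -/
noncomputable def chainProd {V : Type*} [NormedAddCommGroup V] [InnerProductSpace ℝ V]
    (g : ℕ → V →L[ℝ] V) : ℕ → V →L[ℝ] V
  | 0 => ContinuousLinearMap.id ℝ V
  | (i + 1) => (g i).comp (chainProd g i)

section helpers

lemma le_of_sq_le_sq_aux {a b : ℝ} (hb : 0 ≤ b) (h : a ^ 2 ≤ b ^ 2) : a ≤ b :=
  (le_abs_self a).trans (abs_le_of_sq_le_sq h hb)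

variable {V : Type*} [NormedAddCommGroup V] [InnerProductSpace ℝ V]

lemma top_inner [FiniteDimensional ℝ V] (B : V →L[ℝ] V) (v : V) (hv : ‖v‖ = 1)
    (hB : ‖B v‖ = ‖B‖) (w : V) : ⟪B v, B w⟫ = ‖B‖ ^ 2 * ⟪v, w⟫ := by
  have : CompleteSpace V := FiniteDimensional.complete ℝ V
  have h1 : ‖B.adjoint (B v)‖ ≤ ‖B‖ ^ 2 := by
    have := B.adjoint.le_opNorm (B v)
    rw [LinearIsometryEquiv.norm_map, hB] at this
    nlinarith
  have h2 : ‖B.adjoint (B v) - (‖B‖ ^ 2) • v‖ ^ 2 ≤ 0 := by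
    rw [norm_sub_sq_real, real_inner_smul_right, ContinuousLinearMap.adjoint_inner_left,
      real_inner_self_eq_norm_sq, hB, norm_smul, hv]
    have h3 : ‖B.adjoint (B v)‖ ^ 2 ≤ (‖B‖ ^ 2) ^ 2 := by gcongr
    have h4 : ‖(‖B‖ ^ 2 : ℝ)‖ = ‖B‖ ^ 2 := by simp
    rw [h4]
    nlinarith
  have h5 : B.adjoint (B v) = (‖B‖ ^ 2) • v := by
    have h6 : ‖B.adjoint (B v) - (‖B‖ ^ 2) • v‖ = 0 := by
      have := sq_nonneg ‖B.adjoint (B v) - (‖B‖ ^ 2) • v‖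
      exact pow_eq_zero_iff (two_ne_zero) |>.1 (le_antisymm h2 this)
    exact sub_eq_zero.1 (norm_eq_zero.1 h6)
  rw [← ContinuousLinearMap.adjoint_inner_left, h5, real_inner_smul_left]

lemma norm_sq_decomp [FiniteDimensional ℝ V] (B : V →L[ℝ] V) (v : V) (hv : ‖v‖ = 1)
    (hB : ‖B v‖ = ‖B‖) (z : V) :
    ‖B z‖ ^ 2 = ‖B‖ ^ 2 * ⟪v, z⟫ ^ 2 + ‖B (z - ⟪v, z⟫ • v)‖ ^ 2 := by
  have h1 := top_inner B v hv hB z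
  rw [map_sub, map_smul, norm_sub_sq_real, real_inner_smul_right,
    real_inner_comm (B v) (B z), h1,
    norm_smul, hB, mul_pow, Real.norm_eq_abs, sq_abs]
  ring

lemma norm_perp (v : V) (hv : ‖v‖ = 1) (z : V) :
    ⟪v, z - ⟪v, z⟫ • v⟫ = 0 ∧ ‖z - ⟪v, z⟫ • v‖ ^ 2 = ‖z‖ ^ 2 - ⟪v, z⟫ ^ 2 := by
  constructor
  · rw [inner_sub_right, real_inner_smul_right, real_inner_self_eq_norm_sq, hv]; ring
  · rw [norm_sub_sq_real, real_inner_smul_right, real_inner_comm, norm_smul, hv,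
      Real.norm_eq_abs, mul_one, sq_abs]; ring

lemma gap_upper [FiniteDimensional ℝ V] (B : V →L[ℝ] V) (v : V) (k : ℝ) (hv : ‖v‖ = 1)
    (hB : ‖B v‖ = ‖B‖) (hk : ∀ w : V, ⟪v, w⟫ = 0 → ‖B w‖ ≤ k * ‖B‖ * ‖w‖) (z : V) :
    ‖B z‖ ^ 2 ≤ ‖B‖ ^ 2 * ((1 - k ^ 2) * ⟪v, z⟫ ^ 2 + k ^ 2 * ‖z‖ ^ 2) := by
  obtain ⟨h1, h2⟩ := norm_perp v hv z
  have h3 := pow_le_pow_left₀ (norm_nonneg _) (hk _ h1) 2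
  rw [mul_pow, h2] at h3
  rw [norm_sq_decomp B v hv hB z]
  nlinarith

lemma pair_lower [FiniteDimensional ℝ V] (A B : V →L[ℝ] V) (v u : V) (hA : A ≠ 0)
    (hv : ‖v‖ = 1) (hB : ‖B v‖ = ‖B‖) (hu : ‖u‖ = 1) (hAu : ‖A u‖ = ‖A‖) :
    |⟪‖A u‖⁻¹ • A u, v⟫| * (‖A‖ * ‖B‖) ≤ ‖B.comp A‖ := by
  have ha : 0 < ‖A‖ := norm_pos_iff.2 hA
  have h1 := norm_sq_decomp B v hv hB (A u)
  have h2 : |⟪v, A u⟫| * ‖B‖ ≤ ‖B (A u)‖ := by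
    apply le_of_sq_le_sq_aux (norm_nonneg _)
    rw [h1, mul_pow, sq_abs]
    nlinarith [sq_nonneg ‖B (A u - ⟪v, A u⟫ • v)‖]
  have h3 : ‖B (A u)‖ ≤ ‖B.comp A‖ := by
    have := (B.comp A).le_opNorm u
    simpa [hu] using this
  rw [real_inner_smul_left, abs_mul, hAu, abs_of_pos (inv_pos.2 ha), real_inner_comm]
  calc _ = |⟪v, A u⟫| * ‖B‖ := by field_simp
    _ ≤ _ := h2.trans h3

lemma real_ineq (k l c d s y t q : ℝ) (hk0 : 0 ≤ k) (hk : k < 1) (hl0 : 0 ≤ l) (hl : l < 1)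
    (hq : q ^ 2 ≤ t ^ 2 * (1 - c ^ 2)) (hc : c ^ 2 ≤ 1)
    (ht : t ^ 2 ≤ l ^ 2 * y ^ 2) (hd : d = s ^ 2 + y ^ 2) :
    (1 - k ^ 2) * (s * c + q) ^ 2 + k ^ 2 * (s ^ 2 + t ^ 2) ≤
      (l ^ 2 + c ^ 2 - l ^ 2 * c ^ 2 + k ^ 2 - (l ^ 2 + c ^ 2 - l ^ 2 * c ^ 2) * k ^ 2) * d := by
  subst hd
  have hk2 : 0 ≤ 1 - k ^ 2 := by nlinarith
  have hl2 : 0 ≤ 1 - l ^ 2 := by nlinarith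
  have hq2 : q ^ 2 ≤ (l ^ 2 * (1 - c ^ 2)) * y ^ 2 := by nlinarith
  have hm : 0 ≤ l ^ 2 * (1 - c ^ 2) := mul_nonneg (sq_nonneg _) (by linarith)
  have hX : (s * c + q) ^ 2 ≤ (c ^ 2 + l ^ 2 * (1 - c ^ 2)) * (s ^ 2 + y ^ 2) := by
    generalize l ^ 2 * (1 - c ^ 2) = m at *
    have h1 : (s * c * q) ^ 2 ≤ (s ^ 2 * m) * (c ^ 2 * y ^ 2) := by
      nlinarith [mul_le_mul_of_nonneg_left hq2 (sq_nonneg (s * c))]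
    have h2 : 2 * (s * c * q) ≤ s ^ 2 * m + c ^ 2 * y ^ 2 := by
      have h3 : 0 ≤ s ^ 2 * m + c ^ 2 * y ^ 2 := by positivity
      apply le_of_sq_le_sq_aux h3
      nlinarith [sq_nonneg (s ^ 2 * m - c ^ 2 * y ^ 2)]
    nlinarith
  have hY : s ^ 2 + t ^ 2 ≤ s ^ 2 + y ^ 2 := by nlinarith [mul_nonneg hl2 (sq_nonneg y)]
  nlinarith [mul_le_mul_of_nonneg_left hX hk2, mul_le_mul_of_nonneg_left hY (sq_nonneg k)]

lemma pair_upper [FiniteDimensional ℝ V] (A B : V →L[ℝ] V) (v u : V) (k l c : ℝ) (hA : A ≠ 0)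
    (hk0 : 0 ≤ k) (hk1 : k < 1) (hl0 : 0 ≤ l) (hl1 : l < 1)
    (hv : ‖v‖ = 1) (hB : ‖B v‖ = ‖B‖) (hk : ∀ w : V, ⟪v, w⟫ = 0 → ‖B w‖ ≤ k * ‖B‖ * ‖w‖)
    (hu : ‖u‖ = 1) (hAu : ‖A u‖ = ‖A‖) (hl : ∀ w : V, ⟪u, w⟫ = 0 → ‖A w‖ ≤ l * ‖A‖ * ‖w‖)
    (hc : c = |⟪‖A u‖⁻¹ • A u, v⟫|) :
    ‖B.comp A‖ ≤ Real.sqrt (oplus (oplus (l ^ 2) (c ^ 2)) (k ^ 2)) * (‖A‖ * ‖B‖) := by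
  have ha : 0 < ‖A‖ := norm_pos_iff.2 hA
  set p := ‖A u‖⁻¹ • A u with hp
  have hpn : ‖p‖ = 1 := by
    rw [hp, norm_smul, norm_inv, norm_norm, hAu]; field_simp
  have hAp : A u = ‖A‖ • p := by
    rw [hp, smul_smul, hAu, mul_inv_cancel₀ ha.ne', one_smul]
  have hc2 : c ^ 2 = ⟪p, v⟫ ^ 2 := by rw [hc, sq_abs]
  obtain ⟨hr1, hr2⟩ := norm_perp p hpn v
  have hcle : ⟪p, v⟫ ^ 2 ≤ 1 := by
    have := sq_nonneg ‖v - ⟪p, v⟫ • p‖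
    rw [hr2, hv] at this; linarith
  have hnn : 0 ≤ oplus (oplus (l ^ 2) (c ^ 2)) (k ^ 2) := by
    rw [hc2]; unfold oplus
    have h1 : 0 ≤ 1 - k ^ 2 := by nlinarith
    have h2 : 0 ≤ 1 - l ^ 2 := by nlinarith
    nlinarith [mul_nonneg h1 (mul_nonneg (sq_nonneg l) (sub_nonneg.2 hcle)),
      mul_nonneg h1 (sq_nonneg ⟪p, v⟫), sq_nonneg k]
  refine ContinuousLinearMap.opNorm_le_bound _ (by positivity) fun x => ?_
  apply le_of_sq_le_sq_aux (by positivity)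
  rw [mul_pow, mul_pow, Real.sq_sqrt hnn, ContinuousLinearMap.comp_apply]
  obtain ⟨hy1, hy2⟩ := norm_perp u hu x
  set s := ⟪u, x⟫ with hs
  set y := x - s • u with hy
  have hx : A x = (s * ‖A‖) • p + A y := by
    rw [hy, map_sub, map_smul, hAp, ← smul_smul, add_sub_cancel]
  have hAy := hl y hy1
  have hperp : ⟪p, A y⟫ = 0 := by
    have := top_inner A u hu hAu y
    rw [hy1, hAp, real_inner_smul_left] at this
    simpa [ha.ne'] using this
  have hzn : ‖A x‖ ^ 2 = ‖A‖ ^ 2 * s ^ 2 + ‖A y‖ ^ 2 := by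
    rw [norm_sq_decomp A u hu hAu x]
  have hzv : ⟪v, A x⟫ = ‖A‖ * (s * ⟪p, v⟫ + ⟪v, A y⟫ / ‖A‖) := by
    rw [hx, inner_add_right, real_inner_smul_right, real_inner_comm]; field_simp
  have hq : ⟪v, A y⟫ ^ 2 ≤ ‖A y‖ ^ 2 * (1 - ⟪p, v⟫ ^ 2) := by
    have h1 : ⟪v, A y⟫ = ⟪v - ⟪p, v⟫ • p, A y⟫ := by
      rw [inner_sub_left, real_inner_smul_left, hperp]; ring
    have h2 := abs_real_inner_le_norm (v - ⟪p, v⟫ • p) (A y)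
    have h3 := pow_le_pow_left₀ (abs_nonneg _) h2 2
    rw [sq_abs, mul_pow, hr2, hv, ← h1] at h3
    linarith
  have hmain := real_ineq k l ⟪p, v⟫ (‖x‖ ^ 2) s ‖y‖ (‖A y‖ / ‖A‖) (⟪v, A y⟫ / ‖A‖) hk0 hk1 hl0 hl1
    (by rw [div_pow, div_pow, div_mul_eq_mul_div]; gcongr) hcle
    (by
      rw [← mul_pow]
      apply pow_le_pow_left₀ (by positivity)
      rw [div_le_iff₀ ha]; linarith) (by rw [hy2]; ring)
  have hg := gap_upper B v k hv hB hk (A x)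
  have hzn2 : ‖A x‖ ^ 2 = ‖A‖ ^ 2 * (s ^ 2 + (‖A y‖ / ‖A‖) ^ 2) := by
    rw [hzn]; field_simp
  rw [hzv, hzn2] at hg
  refine hg.trans ?_
  rw [hc2]
  unfold oplus
  have := mul_le_mul_of_nonneg_left hmain (by positivity : 0 ≤ ‖A‖ ^ 2 * ‖B‖ ^ 2)
  refine le_trans (le_of_eq ?_) (this.trans (le_of_eq ?_)) <;> ring

end helpers

/-- Multiplicative lower and upper bounds on the expansion rift of a chain
of linear maps in terms of the angles `α_i` and upper angles `β_i`. -/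
theorem chain_rift_bounds {V : Type*} [NormedAddCommGroup V] [InnerProductSpace ℝ V]
    [FiniteDimensional ℝ V]
    (n : ℕ) (hn : 1 ≤ n)
    (g : ℕ → V →L[ℝ] V) (hg : ∀ i < n, g i ≠ 0)
    (κ lam : ℕ → ℝ) (v u : ℕ → V) (α β : ℕ → ℝ)
    (h : ∀ i ∈ Finset.Icc 1 (n - 1),
      chainProd g i ≠ 0 ∧
      (0 ≤ κ i ∧ κ i < 1 ∧ ‖v i‖ = 1 ∧ ‖g i (v i)‖ = ‖g i‖ ∧
        ∀ w : V, ⟪v i, w⟫ = 0 → ‖g i w‖ ≤ κ i * ‖g i‖ * ‖w‖) ∧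
      (0 ≤ lam i ∧ lam i < 1 ∧ ‖u i‖ = 1 ∧
        ‖chainProd g i (u i)‖ = ‖chainProd g i‖ ∧
        ∀ w : V, ⟪u i, w⟫ = 0 → ‖chainProd g i w‖ ≤ lam i * ‖chainProd g i‖ * ‖w‖) ∧
      α i = |⟪‖chainProd g i (u i)‖⁻¹ • (chainProd g i (u i)), v i⟫| ∧
      β i = Real.sqrt (oplus (oplus ((lam i) ^ 2) ((α i) ^ 2)) ((κ i) ^ 2))) :
    (∏ i ∈ Finset.Icc 1 (n - 1), α i)
        ≤ ‖chainProd g n‖ / ∏ i ∈ Finset.range n, ‖g i‖ ∧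
    ‖chainProd g n‖ / ∏ i ∈ Finset.range n, ‖g i‖
        ≤ ∏ i ∈ Finset.Icc 1 (n - 1), β i := by
  obtain ⟨m, rfl⟩ : ∃ m, n = m + 1 := ⟨n - 1, by omega⟩
  simp only [Nat.add_sub_cancel] at *
  have hpos : 0 < ∏ i ∈ Finset.range (m + 1), ‖g i‖ :=
    Finset.prod_pos fun i hi => norm_pos_iff.2 (hg i (Finset.mem_range.1 hi))
  rw [le_div_iff₀ hpos, div_le_iff₀ hpos]
  clear hpos hn
  induction m with
  | zero => simp [chainProd]
  | succ m ih =>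
    obtain ⟨i1, i2⟩ := ih (fun i hi => hg i (by omega))
      (fun i hi => h i (by simp only [Finset.mem_Icc] at *; omega))
    obtain ⟨hA, ⟨hk0, hk1, hv, hB, hk⟩, ⟨hl0, hl1, hu, hAu, hl⟩, hα, hβ⟩ :=
      h (m + 1) (by simp)
    have lo := pair_lower _ _ _ _ hA hv hB hu hAu
    have up := pair_upper _ _ _ _ _ _ _ hA hk0 hk1 hl0 hl1 hv hB hk hu hAu hl hα
    rw [← hα] at lo
    rw [← hβ] at up
    have hα0 : 0 ≤ α (m + 1) := hα ▸ abs_nonneg _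
    have hβ0 : 0 ≤ β (m + 1) := hβ ▸ Real.sqrt_nonneg _
    rw [Finset.prod_Icc_succ_top (by omega), Finset.prod_Icc_succ_top (by omega),
      Finset.prod_range_succ _ (m + 1), show chainProd g (m + 1 + 1) =
      (g (m + 1)).comp (chainProd g (m + 1)) from rfl]
    have hc : 0 ≤ α (m + 1) * ‖g (m + 1)‖ := by positivity
    have hd : 0 ≤ β (m + 1) * ‖g (m + 1)‖ := by positivity
    constructor
    · nlinarith [mul_le_mul_of_nonneg_left i1 hc]
    · nlinarith [mul_le_mul_of_nonneg_left i2 hd]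
end

section
/- Let V be a real inner product space, g a linear map on V, and p, q ∈ V linearly independent unit vectors with g p ≠ 0 and g q ≠ 0. Let v_p(q) := (q − ⟨p,q⟩·p)/‖q − ⟨p,q⟩·p‖ be the unit vector in the direction of the component of q orthogonal to p, and for vectors a, b set N(a,b) := √(‖a‖²·‖b‖² − ⟨a,b⟩²). Then δ(g p, g q)/δ(p,q) = N(g p, g v_p(q)) / (‖g p‖·‖g q‖). -/
open RealInnerProductSpace

/-- `N(a,b) = √(‖a‖²‖b‖² − ⟪a,b⟫²)`, the norm of the wedge product `a ∧ b`. -/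
noncomputable def wedgeN {V : Type*} [NormedAddCommGroup V] [InnerProductSpace ℝ V]
    (a b : V) : ℝ :=
  Real.sqrt (‖a‖ ^ 2 * ‖b‖ ^ 2 - ⟪a, b⟫ ^ 2)

/-- `v_p(q)`, the unit vector in the direction of the component of `q` orthogonal to `p`. -/
noncomputable def vperp {V : Type*} [NormedAddCommGroup V] [InnerProductSpace ℝ V]
    (p q : V) : V :=
  ‖q - ⟪p, q⟫ • p‖⁻¹ • (q - ⟪p, q⟫ • p)

theorem pdelta_eq_aux {V : Type*} [NormedAddCommGroup V] [InnerProductSpace ℝ V]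
    (a b : V) (ha : a ≠ 0) (hb : b ≠ 0) : pdelta a b = wedgeN a b / (‖a‖ * ‖b‖) := by
  have ha' : ‖a‖ ≠ 0 := norm_ne_zero_iff.mpr ha
  have hb' : ‖b‖ ≠ 0 := norm_ne_zero_iff.mpr hb
  have h0 : 0 ≤ ‖a‖ * ‖b‖ := by positivity
  unfold pdelta wedgeN
  rw [← Real.sqrt_sq h0, ← Real.sqrt_div' _ (sq_nonneg _)]
  congr 1
  field_simp

theorem wedgeN_aux {V : Type*} [NormedAddCommGroup V] [InnerProductSpace ℝ V]
    (a b : V) (c d : ℝ) (hd : 0 ≤ d) :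
    wedgeN a (d • (b - c • a)) = d * wedgeN a b := by
  unfold wedgeN
  rw [← Real.sqrt_sq hd, ← Real.sqrt_mul (sq_nonneg _), Real.sqrt_sq hd]
  congr 1
  simp only [← real_inner_self_eq_norm_sq, inner_smul_left, inner_smul_right, inner_sub_left,
    inner_sub_right, real_inner_comm a b, conj_trivial]
  ring

theorem pdelta_unit_aux {V : Type*} [NormedAddCommGroup V] [InnerProductSpace ℝ V]
    (p q : V) (hp : ‖p‖ = 1) (hq : ‖q‖ = 1) : pdelta p q = ‖q - ⟪p, q⟫ • p‖ := by
  unfold pdelta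
  rw [← Real.sqrt_sq (norm_nonneg (q - ⟪p, q⟫ • p))]
  congr 1
  rw [norm_sub_sq_real, inner_smul_right, norm_smul, real_inner_comm p q, hp, hq]
  simp only [Real.norm_eq_abs, mul_one, sq_abs]
  ring

/-- For linearly independent unit vectors `p, q` with `g p ≠ 0 ≠ g q`:
`δ(g p, g q)/δ(p,q) = N(g p, g v_p(q))/(‖g p‖·‖g q‖)`. -/
theorem proj_contraction_ratio {V : Type*} [NormedAddCommGroup V] [InnerProductSpace ℝ V]
    (g : V →ₗ[ℝ] V) (p q : V) (hp : ‖p‖ = 1) (hq : ‖q‖ = 1)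
    (hind : LinearIndependent ℝ ![p, q])
    (hgp : g p ≠ 0) (hgq : g q ≠ 0) :
    pdelta (g p) (g q) / pdelta p q
      = wedgeN (g p) (g (vperp p q)) / (‖g p‖ * ‖g q‖) := by
  rw [pdelta_eq_aux _ _ hgp hgq, pdelta_unit_aux p q hp hq]
  unfold vperp
  rw [map_smul, map_sub, map_smul, wedgeN_aux _ _ _ _ (by positivity)]
  ring
end

section
/- Let V be a finite-dimensional real inner product space, g an invertible linear map on V, and p, q ∈ V nonzero, non-collinear vectors. Then 1/(‖g‖²·‖g⁻¹‖²) ≤ δ(g p, g q)/δ(p,q) ≤ ‖g‖²·‖g⁻¹‖². -/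
open RealInnerProductSpace

lemma pdelta_sq_mul {V : Type*} [NormedAddCommGroup V] [InnerProductSpace ℝ V]
    (p q : V) (hp : p ≠ 0) (hq : q ≠ 0) :
    (pdelta p q * ‖p‖) ^ 2 = ‖p‖ ^ 2 - ⟪p, q⟫ ^ 2 / ‖q‖ ^ 2 := by
  have h1 : 0 < ‖p‖ := norm_pos_iff.2 hp
  have h2 : 0 < ‖q‖ := norm_pos_iff.2 hq
  have h3 : 0 ≤ 1 - ⟪p, q⟫ ^ 2 / (‖p‖ ^ 2 * ‖q‖ ^ 2) := by
    rw [sub_nonneg, div_le_one (by positivity), ← mul_pow, ← sq_abs]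
    exact pow_le_pow_left₀ (abs_nonneg _) (abs_real_inner_le_norm p q) 2
  rw [mul_pow, pdelta, Real.sq_sqrt h3]
  field_simp

lemma norm_sub_smul_sq' {V : Type*} [NormedAddCommGroup V] [InnerProductSpace ℝ V]
    (p q : V) (hp : p ≠ 0) (hq : q ≠ 0) (t : ℝ) :
    ‖p - t • q‖ ^ 2 = (pdelta p q * ‖p‖) ^ 2 + (t * ‖q‖ - ⟪p, q⟫ / ‖q‖) ^ 2 := by
  have h2 : 0 < ‖q‖ := norm_pos_iff.2 hq
  rw [pdelta_sq_mul p q hp hq, norm_sub_sq_real, inner_smul_right, norm_smul, mul_pow,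
    Real.norm_eq_abs, sq_abs]
  field_simp
  ring

lemma pdelta_nonneg' {V : Type*} [NormedAddCommGroup V] [InnerProductSpace ℝ V]
    (p q : V) : 0 ≤ pdelta p q := Real.sqrt_nonneg _

lemma pdelta_le {V : Type*} [NormedAddCommGroup V] [InnerProductSpace ℝ V]
    (p q : V) (hp : p ≠ 0) (hq : q ≠ 0) (t : ℝ) : pdelta p q * ‖p‖ ≤ ‖p - t • q‖ := by
  refine (pow_le_pow_iff_left₀ (mul_nonneg (pdelta_nonneg' p q) (norm_nonneg _))
    (norm_nonneg _) two_ne_zero).1 ?_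
  rw [norm_sub_smul_sq' p q hp hq t]
  nlinarith [sq_nonneg (t * ‖q‖ - ⟪p, q⟫ / ‖q‖)]

lemma pdelta_attained {V : Type*} [NormedAddCommGroup V] [InnerProductSpace ℝ V]
    (p q : V) (hp : p ≠ 0) (hq : q ≠ 0) : ∃ t : ℝ, ‖p - t • q‖ = pdelta p q * ‖p‖ := by
  have h2 : 0 < ‖q‖ := norm_pos_iff.2 hq
  refine ⟨⟪p, q⟫ / ‖q‖ ^ 2, ?_⟩
  rw [← sq_eq_sq₀ (norm_nonneg _) (mul_nonneg (pdelta_nonneg' p q) (norm_nonneg _)),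
    norm_sub_smul_sq' p q hp hq]
  have : ⟪p, q⟫ / ‖q‖ ^ 2 * ‖q‖ - ⟪p, q⟫ / ‖q‖ = 0 := by field_simp; ring
  rw [this]; ring

lemma pdelta_map_le {V : Type*} [NormedAddCommGroup V] [InnerProductSpace ℝ V]
    (g : V ≃L[ℝ] V) (p q : V) (hp : p ≠ 0) (hq : q ≠ 0) :
    pdelta (g p) (g q) ≤
      ‖(g : V →L[ℝ] V)‖ * ‖(g.symm : V →L[ℝ] V)‖ * pdelta p q := by
  have hgp : g p ≠ 0 := by simpa using hp
  have hgq : g q ≠ 0 := by simpa using hq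
  obtain ⟨t, ht⟩ := pdelta_attained p q hp hq
  have h1 := pdelta_le (g p) (g q) hgp hgq t
  have h2 : ‖g p - t • g q‖ ≤ ‖(g : V →L[ℝ] V)‖ * ‖p - t • q‖ := by
    simpa using (g : V →L[ℝ] V).le_opNorm (p - t • q)
  have h3 : ‖p‖ ≤ ‖(g.symm : V →L[ℝ] V)‖ * ‖g p‖ := by
    simpa using (g.symm : V →L[ℝ] V).le_opNorm (g p)
  rw [ht] at h2
  refine le_of_mul_le_mul_right ?_ (norm_pos_iff.2 hgp)
  calc _ ≤ ‖(g : V →L[ℝ] V)‖ * (pdelta p q * ‖p‖) := h1.trans h2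
    _ ≤ ‖(g : V →L[ℝ] V)‖ * (pdelta p q * (‖(g.symm : V →L[ℝ] V)‖ * ‖g p‖)) := by
      have := pdelta_nonneg' p q
      gcongr
    _ = _ := by ring

/-- For invertible `g` and nonzero non-collinear `p, q`:
`1/(‖g‖²‖g⁻¹‖²) ≤ δ(g p, g q)/δ(p,q) ≤ ‖g‖²‖g⁻¹‖²`. -/
theorem pdelta_ratio_bounds {V : Type*} [NormedAddCommGroup V] [InnerProductSpace ℝ V]
    [FiniteDimensional ℝ V]
    (g : V ≃L[ℝ] V) (p q : V) (hp : p ≠ 0) (hq : q ≠ 0)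
    (hind : LinearIndependent ℝ ![p, q]) :
    1 / (‖(g : V →L[ℝ] V)‖ ^ 2 * ‖(g.symm : V →L[ℝ] V)‖ ^ 2)
        ≤ pdelta (g p) (g q) / pdelta p q ∧
    pdelta (g p) (g q) / pdelta p q
        ≤ ‖(g : V →L[ℝ] V)‖ ^ 2 * ‖(g.symm : V →L[ℝ] V)‖ ^ 2 := by
  have hgp : g p ≠ 0 := by simpa using hp
  have hgq : g q ≠ 0 := by simpa using hq
  have h1 := pdelta_map_le g p q hp hq
  have h2 := pdelta_map_le g.symm (g p) (g q) hgp hgq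
  simp only [ContinuousLinearEquiv.symm_apply_apply, ContinuousLinearEquiv.symm_symm] at h2
  have hpos : 0 < pdelta p q := by
    refine lt_of_le_of_ne (pdelta_nonneg' p q) fun h0 => ?_
    obtain ⟨t, ht⟩ := pdelta_attained p q hp hq
    rw [← h0, zero_mul, norm_eq_zero] at ht
    have := LinearIndependent.pair_iff.1 hind 1 (-t) (by rw [← ht]; module)
    exact one_ne_zero this.1
  rw [← mul_pow]
  rw [mul_comm ‖(g.symm : V →L[ℝ] V)‖] at h2
  have hK : 1 ≤ ‖(g : V →L[ℝ] V)‖ * ‖(g.symm : V →L[ℝ] V)‖ := by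
    have a1 : ‖g p‖ ≤ ‖(g : V →L[ℝ] V)‖ * ‖p‖ := (g : V →L[ℝ] V).le_opNorm p
    have a2 : ‖p‖ ≤ ‖(g.symm : V →L[ℝ] V)‖ * ‖g p‖ := by
      simpa using (g.symm : V →L[ℝ] V).le_opNorm (g p)
    refine le_of_mul_le_mul_right ?_ (norm_pos_iff.2 hp)
    have := mul_le_mul_of_nonneg_left a1 (norm_nonneg (g.symm : V →L[ℝ] V))
    linarith
  generalize ‖(g : V →L[ℝ] V)‖ * ‖(g.symm : V →L[ℝ] V)‖ = K at *
  have hKK : K ≤ K ^ 2 := by nlinarith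
  have hn := pdelta_nonneg' (g p) (g q)
  constructor
  · rw [div_le_div_iff₀ (by positivity) hpos]
    nlinarith [mul_le_mul_of_nonneg_right hKK hn]
  · rw [div_le_iff₀ hpos]
    nlinarith [mul_le_mul_of_nonneg_right hKK hpos.le]
end

section
/- Let V be a finite-dimensional real inner product space, g₁, g₂ invertible linear maps on V, and p, q ∈ V nonzero, non-collinear vectors. Then |δ(g₁ p, g₁ q)/δ(p,q) − δ(g₂ p, g₂ q)/δ(p,q)| ≤ C(g₁,g₂)·‖g₁ − g₂‖, where C(g₁,g₂) := (‖g₁⁻¹‖² + ‖g₂‖²·‖g₁⁻¹‖²·‖g₂⁻¹‖²)·(‖g₁‖ + ‖g₂‖). -/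
open RealInnerProductSpace

/-- area of the parallelogram -/
noncomputable def pw {V : Type*} [NormedAddCommGroup V] [InnerProductSpace ℝ V]
    (p q : V) : ℝ :=
  Real.sqrt (‖p‖ ^ 2 * ‖q‖ ^ 2 - ⟪p, q⟫ ^ 2)

section aux
variable {V : Type*} [NormedAddCommGroup V] [InnerProductSpace ℝ V]

lemma pw_nonneg (p q : V) : 0 ≤ pw p q := Real.sqrt_nonneg _

lemma pw_comm (p q : V) : pw p q = pw q p := by
  unfold pw
  rw [real_inner_comm, mul_comm]

lemma pw_le (p q : V) : pw p q ≤ ‖p‖ * ‖q‖ := by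
  unfold pw
  apply Real.sqrt_le_iff.2
  refine ⟨by positivity, ?_⟩
  nlinarith [sq_nonneg (⟪p, q⟫ : ℝ)]

lemma pw_formula (a b : V) : ‖(‖b‖ ^ 2) • a - (⟪b, a⟫ : ℝ) • b‖ = ‖b‖ * pw a b := by
  have h : ‖(‖b‖ ^ 2) • a - (⟪b, a⟫ : ℝ) • b‖ ^ 2
      = ‖b‖ ^ 2 * (‖a‖ ^ 2 * ‖b‖ ^ 2 - ⟪a, b⟫ ^ 2) := by
    rw [norm_sub_sq_real, norm_smul, norm_smul, real_inner_smul_left, real_inner_smul_right,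
      real_inner_comm a b, mul_pow, mul_pow, Real.norm_eq_abs, Real.norm_eq_abs, sq_abs, sq_abs]
    ring
  rw [← Real.sqrt_sq (norm_nonneg ((‖b‖ ^ 2) • a - (⟪b, a⟫ : ℝ) • b)), h,
    Real.sqrt_mul (by positivity), Real.sqrt_sq (norm_nonneg _), pw]

lemma pw_tri (a c b : V) : pw a b ≤ pw c b + ‖a - c‖ * ‖b‖ := by
  by_cases hb : b = 0
  · subst hb; simp [pw]
  have hb' : 0 < ‖b‖ := norm_pos_iff.2 hb
  have h : ‖b‖ * pw a b ≤ ‖b‖ * pw c b + ‖b‖ * pw (a - c) b := by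
    rw [← pw_formula, ← pw_formula, ← pw_formula]
    refine le_trans (le_of_eq ?_) (norm_add_le _ _)
    congr 1
    rw [inner_sub_right]
    module
  have h2 : pw a b ≤ pw c b + pw (a - c) b := by
    rw [← mul_add] at h
    exact le_of_mul_le_mul_left h hb'
  linarith [pw_le (a - c) b]

lemma pw_tri2 (a b c d : V) : |pw a b - pw c d| ≤ ‖a - c‖ * ‖b‖ + ‖c‖ * ‖b - d‖ := by
  have h1 := pw_tri a c b
  have h2 := pw_tri c a b
  have h3 := pw_tri b d c
  have h4 := pw_tri d b c
  rw [pw_comm b c, pw_comm d c] at h3 h4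
  rw [norm_sub_rev c a] at h2
  rw [norm_sub_rev d b] at h4
  rw [abs_le]; constructor <;> linarith

lemma pw_shear (p q : V) (t : ℝ) : pw p (q - t • p) = pw p q := by
  unfold pw
  congr 1
  rw [norm_sub_sq_real, inner_sub_right, real_inner_smul_right, real_inner_smul_right,
    real_inner_self_eq_norm_sq, norm_smul, mul_pow, Real.norm_eq_abs, sq_abs, real_inner_comm q p]
  ring

lemma pdelta_eq (p q : V) (hp : p ≠ 0) (hq : q ≠ 0) : pdelta p q = pw p q / (‖p‖ * ‖q‖) := by
  have hp' : 0 < ‖p‖ := norm_pos_iff.2 hp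
  have hq' : 0 < ‖q‖ := norm_pos_iff.2 hq
  unfold pdelta pw
  rw [← Real.sqrt_sq (by positivity : 0 ≤ ‖p‖ * ‖q‖), ← Real.sqrt_div' _ (by positivity)]
  congr 1
  field_simp

lemma final_arith {A1 A2 B1 B2 P w S M1 M2 N : ℝ} (hA2 : 0 ≤ A2) (hB1 : 0 < B1) (hB2 : 0 < B2)
    (hP : 0 < P) (hw : 0 < w) (hS : 0 ≤ S) (hA : |A1 - A2| ≤ w * S) (hB : |B2 - B1| ≤ P * S)
    (hN : A2 ≤ N * w) (h1 : P ≤ M1 * B1) (h2 : P ≤ M2 * B2) :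
    |(A1 / B1) / (w / P) - (A2 / B2) / (w / P)| ≤ (M1 + N * M1 * M2) * S := by
  have e : (A1 / B1) / (w / P) - (A2 / B2) / (w / P)
      = ((A1 - A2) / w) * (P / B1) + (A2 / w) * ((P / B1) * (P / B2) * ((B2 - B1) / P)) := by
    field_simp
    ring
  have hr1 : P / B1 ≤ M1 := (div_le_iff₀ hB1).2 h1
  have hr2 : P / B2 ≤ M2 := (div_le_iff₀ hB2).2 h2
  have hx : |(A1 - A2) / w| ≤ S := by
    rw [abs_div, abs_of_pos hw, div_le_iff₀ hw]; linarith
  have hy : |(B2 - B1) / P| ≤ S := by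
    rw [abs_div, abs_of_pos hP, div_le_iff₀ hP]; linarith
  have hz : A2 / w ≤ N := (div_le_iff₀ hw).2 hN
  have p1 : 0 < P / B1 := by positivity
  have p2 : 0 < P / B2 := by positivity
  have p3 : 0 ≤ A2 / w := by positivity
  have hM1 : 0 ≤ M1 := p1.le.trans hr1
  have hM2 : 0 ≤ M2 := p2.le.trans hr2
  have hN0 : 0 ≤ N := p3.trans hz
  rw [e]
  refine (abs_add_le _ _).trans ?_
  rw [abs_mul, abs_mul (A2 / w), abs_mul, abs_mul, abs_of_pos p1, abs_of_pos p2, abs_of_nonneg p3]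
  calc _ ≤ S * M1 + N * (M1 * M2 * S) := by gcongr
    _ = _ := by ring

end aux


/-- Lipschitz dependence of the projective contraction ratio on the
(invertible) linear map. -/
theorem pdelta_ratio_lipschitz {V : Type*} [NormedAddCommGroup V] [InnerProductSpace ℝ V]
    [FiniteDimensional ℝ V]
    (g₁ g₂ : V ≃L[ℝ] V) (p q : V) (hp : p ≠ 0) (hq : q ≠ 0)
    (hind : LinearIndependent ℝ ![p, q]) :
    |pdelta (g₁ p) (g₁ q) / pdelta p q - pdelta (g₂ p) (g₂ q) / pdelta p q|
      ≤ (‖(g₁.symm : V →L[ℝ] V)‖ ^ 2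
          + ‖(g₂ : V →L[ℝ] V)‖ ^ 2 * ‖(g₁.symm : V →L[ℝ] V)‖ ^ 2
              * ‖(g₂.symm : V →L[ℝ] V)‖ ^ 2)
        * (‖(g₁ : V →L[ℝ] V)‖ + ‖(g₂ : V →L[ℝ] V)‖)
        * ‖(g₁ : V →L[ℝ] V) - (g₂ : V →L[ℝ] V)‖ := by
  have hp' : 0 < ‖p‖ := norm_pos_iff.2 hp
  have hq' : 0 < ‖q‖ := norm_pos_iff.2 hq
  have n1 : ∀ x, x ≠ 0 → g₁ x ≠ 0 := fun x hx => by simpa using hx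
  have n2 : ∀ x, x ≠ 0 → g₂ x ≠ 0 := fun x hx => by simpa using hx
  have b1 : ∀ x, ‖g₁ x‖ ≤ ‖(g₁ : V →L[ℝ] V)‖ * ‖x‖ := fun x => (g₁ : V →L[ℝ] V).le_opNorm x
  have b2 : ∀ x, ‖g₂ x‖ ≤ ‖(g₂ : V →L[ℝ] V)‖ * ‖x‖ := fun x => (g₂ : V →L[ℝ] V).le_opNorm x
  have bd : ∀ x, ‖g₁ x - g₂ x‖ ≤ ‖(g₁ : V →L[ℝ] V) - (g₂ : V →L[ℝ] V)‖ * ‖x‖ :=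
    fun x => ((g₁ : V →L[ℝ] V) - (g₂ : V →L[ℝ] V)).le_opNorm x
  have c1 : ∀ x, ‖x‖ ≤ ‖(g₁.symm : V →L[ℝ] V)‖ * ‖g₁ x‖ := fun x => by
    simpa using (g₁.symm : V →L[ℝ] V).le_opNorm (g₁ x)
  have c2 : ∀ x, ‖x‖ ≤ ‖(g₂.symm : V →L[ℝ] V)‖ * ‖g₂ x‖ := fun x => by
    simpa using (g₂.symm : V →L[ℝ] V).le_opNorm (g₂ x)
  generalize ‖(g₁ : V →L[ℝ] V) - (g₂ : V →L[ℝ] V)‖ = D at *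
  generalize ‖(g₁ : V →L[ℝ] V)‖ = N1 at *
  generalize ‖(g₂ : V →L[ℝ] V)‖ = N2 at *
  generalize ‖(g₁.symm : V →L[ℝ] V)‖ = M1 at *
  generalize ‖(g₂.symm : V →L[ℝ] V)‖ = M2 at *
  have nn : ∀ {c y : ℝ}, 0 ≤ y → y ≤ c * ‖p‖ → 0 ≤ c := fun h0 h =>
    nonneg_of_mul_nonneg_left (h0.trans h) hp'
  have hD : 0 ≤ D := nn (norm_nonneg _) (bd p)
  have hN1 : 0 ≤ N1 := nn (norm_nonneg _) (b1 p)
  have hN2 : 0 ≤ N2 := nn (norm_nonneg _) (b2 p)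
  obtain ⟨t, ht⟩ : ∃ t : ℝ, t = ⟪p, q⟫ / ‖p‖ ^ 2 := ⟨_, rfl⟩
  obtain ⟨r, hr⟩ : ∃ r : V, r = q - t • p := ⟨_, rfl⟩
  have hpr : (⟪p, r⟫ : ℝ) = 0 := by
    rw [hr, inner_sub_right, real_inner_smul_right, real_inner_self_eq_norm_sq, ht]
    field_simp
    ring
  have hr0 : r ≠ 0 := by
    intro h0
    rw [LinearIndependent.pair_iff] at hind
    have := hind (-t) 1 (by rw [one_smul, neg_smul, ← h0, hr]; abel)
    exact one_ne_zero this.2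
  have hr' : 0 < ‖r‖ := norm_pos_iff.2 hr0
  have hw : pw p q = ‖p‖ * ‖r‖ := by
    rw [← pw_shear p q t, ← hr, pw, hpr, ← mul_pow]
    simp [Real.sqrt_sq (mul_nonneg hp'.le hr'.le)]
  have hA1 : pw (g₁ p) (g₁ q) = pw (g₁ p) (g₁ r) := by
    rw [hr, map_sub, map_smul, pw_shear]
  have hA2 : pw (g₂ p) (g₂ q) = pw (g₂ p) (g₂ r) := by
    rw [hr, map_sub, map_smul, pw_shear]
  rw [pdelta_eq _ _ hp hq, pdelta_eq _ _ (n1 p hp) (n1 q hq), pdelta_eq _ _ (n2 p hp) (n2 q hq),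
    mul_assoc]
  have i1 := norm_pos_iff.2 (n1 p hp)
  have i2 := norm_pos_iff.2 (n1 q hq)
  have i3 := norm_pos_iff.2 (n2 p hp)
  have i4 := norm_pos_iff.2 (n2 q hq)
  refine final_arith (pw_nonneg _ _) (by positivity) (by positivity) (by positivity)
    (by rw [hw]; positivity) (by positivity) ?_ ?_ ?_ ?_ ?_
  · rw [hA1, hA2, hw]
    refine (pw_tri2 _ _ _ _).trans ?_
    calc _ ≤ (D * ‖p‖) * (N1 * ‖r‖) + (N2 * ‖p‖) * (D * ‖r‖) := by
          gcongr
          exacts [bd p, b1 r, b2 p, bd r]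
      _ = _ := by ring
  · have e : ‖g₂ p‖ * ‖g₂ q‖ - ‖g₁ p‖ * ‖g₁ q‖
        = (‖g₂ p‖ - ‖g₁ p‖) * ‖g₁ q‖ + ‖g₂ p‖ * (‖g₂ q‖ - ‖g₁ q‖) := by ring
    have f : ∀ x, |‖g₂ x‖ - ‖g₁ x‖| ≤ D * ‖x‖ := fun x => by
      rw [abs_sub_comm]
      exact (abs_norm_sub_norm_le _ _).trans (bd x)
    rw [e]
    refine (abs_add_le _ _).trans ?_
    rw [abs_mul, abs_mul, abs_of_pos i2, abs_of_pos i3]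
    calc _ ≤ (D * ‖p‖) * (N1 * ‖q‖) + (N2 * ‖p‖) * (D * ‖q‖) := by
          gcongr
          exacts [f p, b1 q, b2 p, f q]
      _ = _ := by ring
  · rw [hA2, hw]
    refine (pw_le _ _).trans ?_
    calc _ ≤ (N2 * ‖p‖) * (N2 * ‖r‖) := by
          gcongr
          exacts [b2 p, b2 r]
      _ = _ := by ring
  · calc _ ≤ (M1 * ‖g₁ p‖) * (M1 * ‖g₁ q‖) :=
          mul_le_mul (c1 p) (c1 q) hq'.le (hp'.le.trans (c1 p))
      _ = _ := by ring
  · calc _ ≤ (M2 * ‖g₂ p‖) * (M2 * ‖g₂ q‖) :=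
          mul_le_mul (c2 p) (c2 q) hq'.le (hp'.le.trans (c2 p))
      _ = _ := by ring
end

section
/- Let V be a finite-dimensional real inner product space and 0 < κ < 1. There exists ε₀ > 0 (depending only on κ) such that: whenever g₁, g₂ are nonzero linear maps on V admitting κ-gap most expanding directions v₁, v₂ respectively, and the relative distance d_rel(g₁,g₂) := ‖g₁ − g₂‖ / max{‖g₁‖, ‖g₂‖} satisfies d_rel(g₁,g₂) ≤ ε₀, then min{‖v₁ − v₂‖, ‖v₁ + v₂‖} ≤ (16/(1 − κ²)) · d_rel(g₁,g₂). -/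
open RealInnerProductSpace

/-- A unit vector realizing the norm is an eigenvector of `g* g`. -/
theorem top_inner_s15 {V : Type*} [NormedAddCommGroup V]
    [InnerProductSpace ℝ V] [FiniteDimensional ℝ V] (g : V →L[ℝ] V) (v : V)
    (hv : ‖v‖ = 1) (hg : ‖g v‖ = ‖g‖) (u : V) : ⟪g v, g u⟫ = ‖g‖ ^ 2 * ⟪v, u⟫ := by
  haveI : CompleteSpace V := FiniteDimensional.complete ℝ V
  set a := ContinuousLinearMap.adjoint g (g v) with ha
  have hav : ⟪a, v⟫ = ‖g‖ ^ 2 := by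
    rw [ha, ContinuousLinearMap.adjoint_inner_left, real_inner_self_eq_norm_sq, hg]
  have han : ‖a‖ ≤ ‖g‖ ^ 2 := by
    have h := (ContinuousLinearMap.adjoint g).le_opNorm (g v)
    rw [LinearIsometryEquiv.norm_map, hg] at h
    rw [pow_two]; exact h
  have h0 : ‖a - (‖g‖ ^ 2) • v‖ ^ 2 ≤ 0 := by
    rw [norm_sub_sq_real, inner_smul_right, hav, norm_smul, hv, Real.norm_of_nonneg (by positivity)]
    nlinarith [pow_le_pow_left₀ (norm_nonneg a) han 2]
  have h1 : a = (‖g‖ ^ 2) • v := by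
    rw [← sub_eq_zero, ← norm_eq_zero]
    exact pow_eq_zero_iff (two_ne_zero) |>.1 (le_antisymm h0 (by positivity))
  rw [← ContinuousLinearMap.adjoint_inner_left, ← ha, h1, real_inner_smul_left]

set_option maxHeartbeats 1000000 in
theorem key_bound {V : Type*} [NormedAddCommGroup V]
    [InnerProductSpace ℝ V] [FiniteDimensional ℝ V]
    (κ : ℝ) (hκ0 : 0 < κ) (hκ1 : κ < 1) (g₁ g₂ : V →L[ℝ] V) (hg2 : g₂ ≠ 0)
    (v₁ v₂ : V) (h1 : ‖v₁‖ = 1) (h2 : ‖v₂‖ = 1)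
    (e1 : ‖g₁ v₁‖ = ‖g₁‖) (k1 : ∀ w : V, ⟪v₁, w⟫ = 0 → ‖g₁ w‖ ≤ κ * ‖g₁‖ * ‖w‖)
    (e2 : ‖g₂ v₂‖ = ‖g₂‖) (hle : ‖g₁‖ ≤ ‖g₂‖) :
    min ‖v₁ - v₂‖ ‖v₁ + v₂‖ ≤ (16 / (1 - κ ^ 2)) * (‖g₁ - g₂‖ / ‖g₂‖) := by
  have hp : 0 < ‖g₂‖ := norm_pos_iff.2 hg2
  have hκ : 0 < 1 - κ ^ 2 := by nlinarith
  set c := ⟪v₁, v₂⟫ with hc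
  set u := v₂ - c • v₁ with hu
  have hvu : ⟪v₁, u⟫ = 0 := by
    rw [hu, inner_sub_right, inner_smul_right, real_inner_self_eq_norm_sq, h1]; simp [hc]
  have hv2 : v₂ = c • v₁ + u := by rw [hu]; abel
  have hvu2 : ⟪v₂, u⟫ = ‖u‖ ^ 2 := by
    conv_lhs => rw [hv2]
    rw [inner_add_left, real_inner_smul_left, hvu, real_inner_self_eq_norm_sq]; ring
  have hun : ‖u‖ ^ 2 = 1 - c ^ 2 := by
    rw [← hvu2, hu, inner_sub_right, inner_smul_right, real_inner_self_eq_norm_sq, h2,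
      real_inner_comm, ← hc]; ring
  have hA2 := top_inner_s15 g₂ v₂ h2 e2 u
  have hA1 : ⟪g₁ v₂, g₁ u⟫ = ‖g₁ u‖ ^ 2 := by
    conv_lhs => rw [hv2]
    rw [map_add, map_smul, inner_add_left, real_inner_smul_left, top_inner_s15 g₁ v₁ h1 e1 u, hvu,
      real_inner_self_eq_norm_sq]; ring
  have hk := pow_le_pow_left₀ (norm_nonneg _) (k1 u hvu) 2
  set D := ‖g₁ - g₂‖ with hD
  have hD0 : 0 ≤ D := norm_nonneg _
  have hdiff : ⟪g₂ v₂, g₂ u⟫ - ⟪g₁ v₂, g₁ u⟫ = -⟪(g₁ - g₂) v₂, g₂ u⟫ - ⟪g₁ v₂, (g₁ - g₂) u⟫ := by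
    simp only [ContinuousLinearMap.sub_apply, inner_sub_left, inner_sub_right]; ring
  have b1 : -⟪(g₁ - g₂) v₂, g₂ u⟫ ≤ D * (‖g₂‖ * ‖u‖) := by
    refine (neg_le_abs _).trans ((abs_real_inner_le_norm _ _).trans ?_)
    have := (g₁ - g₂).le_opNorm v₂
    rw [h2, mul_one] at this
    exact mul_le_mul this (g₂.le_opNorm u) (norm_nonneg _) hD0
  have b2 : -⟪g₁ v₂, (g₁ - g₂) u⟫ ≤ ‖g₂‖ * (D * ‖u‖) := by
    refine (neg_le_abs _).trans ((abs_real_inner_le_norm _ _).trans ?_)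
    have := g₁.le_opNorm v₂
    rw [h2, mul_one] at this
    exact mul_le_mul (this.trans hle) ((g₁ - g₂).le_opNorm u) (norm_nonneg _) hp.le
  have hsq : ‖g₁‖ ^ 2 ≤ ‖g₂‖ ^ 2 := pow_le_pow_left₀ (norm_nonneg _) hle 2
  have hmain : (1 - κ ^ 2) * ‖g₂‖ ^ 2 * ‖u‖ ^ 2 ≤ 2 * D * ‖g₂‖ * ‖u‖ := by
    have : κ ^ 2 * ‖u‖ ^ 2 * ‖g₁‖ ^ 2 ≤ κ ^ 2 * ‖u‖ ^ 2 * ‖g₂‖ ^ 2 := by gcongr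
    rw [hvu2] at hA2
    nlinarith
  have hs : ‖u‖ ≤ 2 / (1 - κ ^ 2) * (D / ‖g₂‖) := by
    rw [div_mul_div_comm, le_div_iff₀ (by positivity)]
    rcases (norm_nonneg u).eq_or_lt with h | h
    · rw [← h]; simp; exact hD0
    · have : (‖u‖ * ‖g₂‖) * (‖u‖ * ((1 - κ ^ 2) * ‖g₂‖)) ≤ (‖u‖ * ‖g₂‖) * (2 * D) := by nlinarith
      exact le_of_mul_le_mul_left this (by positivity)
  have hfin : min ‖v₁ - v₂‖ ‖v₁ + v₂‖ ≤ 2 * ‖u‖ := by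
    have hc1 : c ^ 2 ≤ 1 := by nlinarith [sq_nonneg ‖u‖]
    have hc2 := abs_le_of_sq_le_sq' (by simpa using hc1 : c ^ 2 ≤ 1 ^ 2) zero_le_one
    have hs1 := norm_sub_sq_real v₁ v₂
    have hs2 := norm_add_sq_real v₁ v₂
    rw [h1, h2, ← hc] at hs1 hs2
    rcases le_total 0 c with h | h
    · refine (min_le_left _ _).trans (abs_le_of_sq_le_sq' ?_ (by positivity)).2
      rw [mul_pow, hun, hs1]
      have := mul_nonneg h (sub_nonneg.2 hc2.2)
      nlinarith only [this, hc1, h, hc2.1, hc2.2]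
    · refine (min_le_right _ _).trans (abs_le_of_sq_le_sq' ?_ (by positivity)).2
      rw [mul_pow, hun, hs2]
      have := mul_nonneg (neg_nonneg.2 h) (by linarith [hc2.1] : 0 ≤ 1 + c)
      nlinarith only [this, hc1, h, hc2.1, hc2.1]
  have hq : 0 ≤ 1 / (1 - κ ^ 2) * (D / ‖g₂‖) := by positivity
  have e : ∀ t : ℝ, t / (1 - κ ^ 2) * (D / ‖g₂‖) = t * (1 / (1 - κ ^ 2) * (D / ‖g₂‖)) := by
    intro t; ring
  rw [e] at hs ⊢
  linarith



/-- Local Lipschitz continuity of the most expanding direction, with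
respect to the relative distance `d_rel(g₁,g₂) = ‖g₁ − g₂‖ / max ‖g₁‖ ‖g₂‖`. -/
theorem most_expanding_lipschitz {V : Type*} [NormedAddCommGroup V]
    [InnerProductSpace ℝ V] [FiniteDimensional ℝ V]
    (κ : ℝ) (hκ0 : 0 < κ) (hκ1 : κ < 1) :
    ∃ ε₀ > (0:ℝ), ∀ g₁ g₂ : V →L[ℝ] V, g₁ ≠ 0 → g₂ ≠ 0 →
      ∀ v₁ v₂ : V, ‖v₁‖ = 1 → ‖v₂‖ = 1 →
      ‖g₁ v₁‖ = ‖g₁‖ → (∀ w : V, ⟪v₁, w⟫ = 0 → ‖g₁ w‖ ≤ κ * ‖g₁‖ * ‖w‖) →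
      ‖g₂ v₂‖ = ‖g₂‖ → (∀ w : V, ⟪v₂, w⟫ = 0 → ‖g₂ w‖ ≤ κ * ‖g₂‖ * ‖w‖) →
      ‖g₁ - g₂‖ / max ‖g₁‖ ‖g₂‖ ≤ ε₀ →
      min ‖v₁ - v₂‖ ‖v₁ + v₂‖
        ≤ (16 / (1 - κ ^ 2)) * (‖g₁ - g₂‖ / max ‖g₁‖ ‖g₂‖) := by
  refine ⟨1, one_pos, ?_⟩
  intro g₁ g₂ n1 n2 v₁ v₂ h1 h2 e1 k1 e2 k2 _
  rcases le_total ‖g₁‖ ‖g₂‖ with h | h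
  · rw [max_eq_right h]
    exact key_bound κ hκ0 hκ1 g₁ g₂ n2 v₁ v₂ h1 h2 e1 k1 e2 h
  · rw [max_eq_left h, norm_sub_rev v₁ v₂, add_comm v₁ v₂, norm_sub_rev g₁ g₂]
    exact key_bound κ hκ0 hκ1 g₂ g₁ n1 v₂ v₁ h2 h1 e2 k2 e1 h
end

section
/- (Avalanche Principle, norm estimate.) There exist universal constants c > 0 and C > 0 such that: for every m ≥ 1, every n ≥ 2, all 0 < ε < 1 and 0 < κ ≤ c·ε², and every chain of nonzero linear maps g₀, g₁, …, g_{n−1} on ℝ^m (with its Euclidean inner product) such that each g_i admits a κ-gap most expanding direction v_i and such that |⟨g_{i−1} v_{i−1}/‖g_{i−1} v_{i−1}‖, v_i⟩| ≥ ε for all 1 ≤ i ≤ n−1, one has |log ‖g_{n−1} ⋯ g₁ g₀‖ + Σ_{i=1}^{n−2} log ‖g_i‖ − Σ_{i=1}^{n−1} log ‖g_i g_{i−1}‖| ≤ C · n · κ/ε². -/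
open RealInnerProductSpace

lemma av_step0 {V : Type*} [NormedAddCommGroup V] [InnerProductSpace ℝ V]
    (g : V →L[ℝ] V) (v : V) (κ : ℝ) (hg : g ≠ 0) (hκ : 0 < κ) (hv : ‖v‖ = 1)
    (hgv : ‖g v‖ = ‖g‖) (hw : ∀ w, ⟪v, w⟫ = 0 → ‖g w‖ ≤ κ * ‖g‖ * ‖w‖) (x : V) :
    ∃ r, g x = (⟪v, x⟫ * ‖g‖) • (‖g v‖⁻¹ • g v) + r ∧ ‖r‖ ≤ κ * ‖g‖ * ‖x‖ := by
  have ha : 0 < ‖g‖ := norm_pos_iff.2 hg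
  refine ⟨g (x - ⟪v, x⟫ • v), ?_, ?_⟩
  · rw [map_sub, map_smul, smul_smul, hgv, mul_assoc, mul_inv_cancel₀ ha.ne', mul_one]
    abel
  · have horth : ⟪v, x - ⟪v, x⟫ • v⟫ = 0 := by
      rw [inner_sub_right, inner_smul_right, real_inner_self_eq_norm_sq, hv]; ring
    refine (hw _ horth).trans ?_
    have h2 : ‖x - ⟪v, x⟫ • v‖ ^ 2 ≤ ‖x‖ ^ 2 := by
      rw [norm_sub_sq_real, norm_smul, hv, inner_smul_right, real_inner_comm, Real.norm_eq_abs,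
        mul_one, sq_abs]
      nlinarith [sq_nonneg ⟪v, x⟫]
    have h3 : ‖x - ⟪v, x⟫ • v‖ ≤ ‖x‖ := (sq_le_sq₀ (norm_nonneg _) (norm_nonneg _)).1 h2
    gcongr

lemma av_step {V : Type*} [NormedAddCommGroup V] [InnerProductSpace ℝ V]
    (g : V →L[ℝ] V) (v : V) (κ : ℝ) (hg : g ≠ 0) (hκ : 0 < κ) (hv : ‖v‖ = 1)
    (hgv : ‖g v‖ = ‖g‖) (hw : ∀ w, ⟪v, w⟫ = 0 → ‖g w‖ ≤ κ * ‖g‖ * ‖w‖)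
    (e r : V) (he : ‖e‖ = 1) (t B δ : ℝ) (ht : |t| ≤ B) (hr : ‖r‖ ≤ δ * B) :
    ∃ t' r', g (t • e + r) = t' • (‖g v‖⁻¹ • g v) + r' ∧
      |t'| ≤ ‖g‖ * (|t| * |⟪e, v⟫| + δ * B) ∧
      ‖g‖ * (|t| * |⟪e, v⟫| - δ * B) ≤ |t'| ∧
      ‖r'‖ ≤ κ * ‖g‖ * ((1 + δ) * B) := by
  obtain ⟨r', h1, h2⟩ := av_step0 g v κ hg hκ hv hgv hw (t • e + r)
  have hx : ‖t • e + r‖ ≤ (1 + δ) * B := by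
    refine (norm_add_le _ _).trans ?_
    rw [norm_smul, he, Real.norm_eq_abs]; linarith
  have hs : ⟪v, t • e + r⟫ = t * ⟪e, v⟫ + ⟪v, r⟫ := by
    rw [inner_add_right, inner_smul_right, real_inner_comm]
  have hvr : |⟪v, r⟫| ≤ δ * B := by
    refine (abs_real_inner_le_norm _ _).trans ?_
    rw [hv]; linarith
  refine ⟨_, r', h1, ?_, ?_, h2.trans (by gcongr)⟩
  · rw [abs_mul, abs_norm, mul_comm, hs]
    gcongr
    refine (abs_add_le _ _).trans ?_
    rw [abs_mul]; linarith
  · rw [abs_mul, abs_norm, mul_comm |_| ‖g‖, hs]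
    gcongr
    have := abs_sub_abs_le_abs_sub (t * ⟪e, v⟫) (-⟪v, r⟫)
    rw [abs_mul, abs_neg, sub_neg_eq_add] at this
    linarith

lemma av_exp (α ε δ : ℝ) (hε : 0 < ε) (hδ : 0 < δ) (hδε : δ ≤ ε / 4) (hα : ε ≤ α) :
    α + δ ≤ α * Real.exp (2 * δ / ε) ∧ α * Real.exp (-(2 * δ / ε)) ≤ α - δ := by
  have hα0 : 0 < α := by linarith
  have h1 := Real.add_one_le_exp (2 * δ / ε)
  have h0 : 2 * δ / ε * ε = 2 * δ := by field_simp
  have hη : 0 < 2 * δ / ε := by positivity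
  set η := 2 * δ / ε
  have h2 : 2 * δ ≤ η * α := by nlinarith
  constructor
  · nlinarith
  · rw [Real.exp_neg, ← div_eq_mul_inv, div_le_iff₀ (Real.exp_pos _)]
    have : α ≤ (α - δ) * (η + 1) := by nlinarith
    refine this.trans ?_
    have : 0 ≤ α - δ := by linarith
    gcongr

lemma av_norm {V : Type*} [NormedAddCommGroup V] [InnerProductSpace ℝ V]
    (g : ℕ → V →L[ℝ] V) (v : ℕ → V) (n : ℕ) (ε κ : ℝ) (hε : 0 < ε) (hε1 : ε < 1)
    (hκ : 0 < κ) (hκε : κ ≤ 1 / 8 * ε ^ 2)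
    (hg : ∀ i < n, g i ≠ 0)
    (hv : ∀ i < n, ‖v i‖ = 1 ∧ ‖g i (v i)‖ = ‖g i‖ ∧
      ∀ w, ⟪v i, w⟫ = 0 → ‖g i w‖ ≤ κ * ‖g i‖ * ‖w‖)
    (hα : ∀ i, i + 1 < n → ε ≤ |⟪‖g i (v i)‖⁻¹ • (g i (v i)), v (i + 1)⟫|)
    (k : ℕ) (hk : k < n) :
    |Real.log ‖chainProd g (k + 1)‖ - (Real.log ‖g 0‖ + ∑ i ∈ Finset.range k,
      (Real.log ‖g (i + 1)‖ + Real.log |⟪‖g i (v i)‖⁻¹ • (g i (v i)), v (i + 1)⟫|))|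
      ≤ (k + 1) * (4 * κ / ε ^ 2) := by
  obtain ⟨δ, hδdef⟩ : ∃ δ, δ = 2 * κ / ε := ⟨_, rfl⟩
  have hδε' : δ * ε = 2 * κ := by rw [hδdef]; field_simp
  have hδ : 0 < δ := by rw [hδdef]; positivity
  have hδε : δ ≤ ε / 4 := by
    have : δ * ε ≤ ε / 4 * ε := by rw [hδε']; linarith
    exact le_of_mul_le_mul_right this hε
  have hη : 4 * κ / ε ^ 2 = 2 * δ / ε := by rw [hδdef]; field_simp; norm_num
  rw [hη]
  have hηδ : 2 * δ ≤ 2 * δ / ε := by rw [le_div_iff₀ hε]; nlinarith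
  have hE : ∀ α, ε ≤ α → _ := fun α h => av_exp α ε δ hε hδ hδε h
  set η := 2 * δ / ε with hηdef
  clear_value η
  set α : ℕ → ℝ := fun i => |⟪‖g i (v i)‖⁻¹ • (g i (v i)), v (i + 1)⟫| with hαdef
  set L : ℕ → ℝ := fun k => Real.log ‖g 0‖ + ∑ i ∈ Finset.range k,
      (Real.log ‖g (i + 1)‖ + Real.log (α i)) with hL
  have hαε : ∀ i, i + 1 < n → ε ≤ α i := hα
  have hpos : ∀ i < n, 0 < ‖g i‖ := fun i hi => norm_pos_iff.2 (hg i hi)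
  have hL0 : Real.exp (L 0) = ‖g 0‖ := by
    simp only [hL, Finset.range_zero, Finset.sum_empty, add_zero]
    exact Real.exp_log (hpos 0 (by omega))
  have hLs : ∀ k, k + 1 < n → Real.exp (L (k + 1)) = Real.exp (L k) * (‖g (k + 1)‖ * α k) := by
    intro k hk
    simp only [hL, Finset.sum_range_succ, ← add_assoc]
    rw [add_assoc (Real.log ‖g 0‖ + _), Real.exp_add _ (_ + _), Real.exp_add (Real.log ‖g (k+1)‖),
      Real.exp_log (hpos _ hk), Real.exp_log (hε.trans_le (hαε k hk))]
  change |_ - L k| ≤ _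
  clear_value L
  have he : ∀ i < n, ‖‖g i (v i)‖⁻¹ • g i (v i)‖ = 1 := by
    intro i hi
    rw [norm_smul, norm_inv, norm_norm]
    exact inv_mul_cancel₀ (by rw [(hv i hi).2.1]; exact (hpos i hi).ne')
  have hκδ : ∀ a, ε ≤ a → κ * (1 + δ) ≤ δ * (a - δ) := by
    intro a ha
    have : δ * (ε - δ) ≤ δ * (a - δ) := by gcongr
    nlinarith
  have hκδ1 : κ ≤ δ := by nlinarith
  -- upper bound
  have hup : ∀ k, k < n → ∀ x : V, ‖x‖ ≤ 1 → ∃ t r,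
      chainProd g (k + 1) x = t • (‖g k (v k)‖⁻¹ • g k (v k)) + r ∧
      |t| ≤ Real.exp (L k) * Real.exp (k * η) ∧
      ‖r‖ ≤ δ * (Real.exp (L k) * Real.exp (k * η)) := by
    intro k
    induction k with
    | zero =>
      intro hk x hx
      obtain ⟨h1, h2, h3⟩ := hv 0 hk
      obtain ⟨r, hr1, hr2⟩ := av_step0 (g 0) (v 0) κ (hg 0 hk) hκ h1 h2 h3 x
      have hp := hpos 0 hk
      refine ⟨_, r, hr1, ?_, ?_⟩
      · rw [hL0, abs_mul, abs_norm]
        have := abs_real_inner_le_norm (v 0) x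
        rw [h1] at this
        simp
        nlinarith
      · rw [hL0]
        simp
        refine hr2.trans ?_
        have : κ * ‖g 0‖ ≤ δ * ‖g 0‖ := by gcongr
        have h0 : 0 < κ * ‖g 0‖ := by positivity
        nlinarith
    | succ k ih =>
      intro hk x hx
      obtain ⟨t, r, h, ht, hr⟩ := ih (by omega) x hx
      obtain ⟨h1, h2, h3⟩ := hv _ hk
      obtain ⟨t', r', h', ht', -, hr'⟩ := av_step (g (k+1)) (v (k+1)) κ (hg _ hk) hκ h1 h2 h3 _ r
        (he k (by omega)) t _ δ ht hr
      have hp := hpos _ hk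
      have hα' := hαε k hk
      have hEα := (hE _ hα').1
      have hk' := hκδ _ hα'
      have hexp : Real.exp (L (k+1)) * Real.exp ((k+1 : ℕ) * η) =
          ‖g (k+1)‖ * ((Real.exp (L k) * Real.exp (k * η)) * (α k * Real.exp η)) := by
        rw [hLs k hk]; push_cast; rw [add_mul, Real.exp_add, one_mul]; ring
      rw [hexp]
      have hB : 0 < Real.exp (L k) * Real.exp (k * η) := by positivity
      generalize Real.exp (L k) * Real.exp (k * η) = B at *
      refine ⟨t', r', ?_, ht'.trans ?_, hr'.trans ?_⟩
      · rw [chainProd, ContinuousLinearMap.comp_apply, h, h']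
      · change ‖g (k+1)‖ * (|t| * α k + δ * B) ≤ _
        gcongr
        have : |t| * α k ≤ B * α k := by gcongr
        nlinarith
      · calc κ * ‖g (k+1)‖ * ((1 + δ) * B) = ‖g (k+1)‖ * B * (κ * (1 + δ)) := by ring
          _ ≤ ‖g (k+1)‖ * B * (δ * (α k * Real.exp η)) := by
            refine mul_le_mul_of_nonneg_left (hk'.trans ?_) (by positivity)
            refine mul_le_mul_of_nonneg_left ?_ hδ.le
            linarith
          _ = _ := by ring
  -- lower bound
  have hlo : ∀ k, k < n → ∃ t r,
      chainProd g (k + 1) (v 0) = t • (‖g k (v k)‖⁻¹ • g k (v k)) + r ∧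
      Real.exp (L k) * Real.exp (-(k * η)) ≤ |t| ∧ ‖r‖ ≤ δ * |t| := by
    intro k
    induction k with
    | zero =>
      intro hk
      obtain ⟨h1, h2, h3⟩ := hv 0 hk
      have hp := hpos 0 hk
      refine ⟨‖g 0‖, 0, ?_, ?_, ?_⟩
      · rw [h2, smul_smul, mul_inv_cancel₀ hp.ne', one_smul, add_zero]
        rfl
      · rw [hL0]; simp
      · simp; positivity
    | succ k ih =>
      intro hk
      obtain ⟨t, r, h, ht, hr⟩ := ih (by omega)
      obtain ⟨h1, h2, h3⟩ := hv _ hk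
      obtain ⟨t', r', h', -, ht', hr'⟩ := av_step (g (k+1)) (v (k+1)) κ (hg _ hk) hκ h1 h2 h3 _ r
        (he k (by omega)) t _ δ le_rfl hr
      have hp := hpos _ hk
      have hα' := hαε k hk
      have hEα := (hE _ hα').2
      have hk' := hκδ _ hα'
      have hexp : Real.exp (L (k+1)) * Real.exp (-((k+1 : ℕ) * η)) =
          ‖g (k+1)‖ * ((Real.exp (L k) * Real.exp (-(k * η))) * (α k * Real.exp (-η))) := by
        rw [hLs k hk]; push_cast; rw [add_mul, neg_add, Real.exp_add, one_mul]; ring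
      rw [hexp]
      have hB : 0 < Real.exp (L k) * Real.exp (-(k * η)) := by positivity
      generalize Real.exp (L k) * Real.exp (-(k * η)) = B at *
      change ‖g (k+1)‖ * (|t| * α k - δ * |t|) ≤ _ at ht'
      have ht0 := abs_nonneg t
      refine ⟨t', r', ?_, le_trans ?_ ht', hr'.trans ?_⟩
      · rw [chainProd, ContinuousLinearMap.comp_apply, h, h']
      · have h5 : B * (α k * Real.exp (-η)) ≤ |t| * (α k - δ) :=
          mul_le_mul ht hEα (mul_nonneg (by linarith) (Real.exp_pos _).le) ht0
        gcongr
        linarith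
      · calc κ * ‖g (k+1)‖ * ((1 + δ) * |t|) = ‖g (k+1)‖ * |t| * (κ * (1 + δ)) := by ring
          _ ≤ ‖g (k+1)‖ * |t| * (δ * (α k - δ)) := by gcongr
          _ = δ * (‖g (k+1)‖ * (|t| * α k - δ * |t|)) := by ring
          _ ≤ _ := by gcongr
  have hE1 := hE 1 hε1.le
  simp only [one_mul] at hE1
  have hU : ‖chainProd g (k+1)‖ ≤ Real.exp (L k + (k + 1) * η) := by
    have hb : Real.exp (L k) * Real.exp (k * η) * (1 + δ) ≤ Real.exp (L k + (k + 1) * η) := by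
      rw [add_mul, one_mul, ← add_assoc, Real.exp_add, Real.exp_add]
      gcongr
      exact hE1.1
    refine ContinuousLinearMap.opNorm_le_of_unit_norm (Real.exp_pos _).le ?_
    intro x hx
    obtain ⟨t, r, h, ht, hr⟩ := hup k hk x hx.le
    refine le_trans ?_ hb
    rw [h]
    refine (norm_add_le _ _).trans ?_
    rw [norm_smul, he k hk, Real.norm_eq_abs]
    linarith
  have hLo : Real.exp (L k - (k + 1) * η) ≤ ‖chainProd g (k+1)‖ := by
    obtain ⟨t, r, h, ht, hr⟩ := hlo k hk
    have h0 : ‖chainProd g (k+1) (v 0)‖ ≤ ‖chainProd g (k+1)‖ := by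
      have := (chainProd g (k+1)).le_opNorm (v 0)
      rwa [(hv 0 (by omega)).1, mul_one] at this
    refine le_trans ?_ h0
    have h1 : |t| * (1 - δ) ≤ ‖chainProd g (k+1) (v 0)‖ := by
      rw [h]
      have := norm_sub_le_norm_add (t • (‖g k (v k)‖⁻¹ • g k (v k))) r
      rw [norm_smul, he k hk, Real.norm_eq_abs] at this
      linarith
    refine le_trans ?_ h1
    have : Real.exp (L k - (k + 1) * η) =
        Real.exp (L k) * Real.exp (-(k * η)) * Real.exp (-η) := by
      rw [← Real.exp_add, ← Real.exp_add]; congr 1; ring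
    rw [this]
    exact mul_le_mul ht hE1.2 (Real.exp_pos _).le (abs_nonneg _)
  have hP : 0 < ‖chainProd g (k+1)‖ := (Real.exp_pos _).trans_le hLo
  have h1 := (Real.log_le_iff_le_exp hP).2 hU
  have h2 := (Real.le_log_iff_exp_le hP).2 hLo
  rw [abs_le]
  constructor <;> linarith

/-- **Avalanche Principle, norm estimate.** -/
theorem avalanche_principle_norms :
    ∃ c > (0:ℝ), ∃ C > (0:ℝ), ∀ (m n : ℕ), 1 ≤ m → 2 ≤ n →
    ∀ ε κ : ℝ, 0 < ε → ε < 1 → 0 < κ → κ ≤ c * ε ^ 2 →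
    ∀ g : ℕ → (EuclideanSpace ℝ (Fin m) →L[ℝ] EuclideanSpace ℝ (Fin m)),
    ∀ v : ℕ → EuclideanSpace ℝ (Fin m),
    (∀ i < n, g i ≠ 0) →
    (∀ i < n, ‖v i‖ = 1 ∧ ‖g i (v i)‖ = ‖g i‖ ∧
      ∀ w, ⟪v i, w⟫ = 0 → ‖g i w‖ ≤ κ * ‖g i‖ * ‖w‖) →
    (∀ i, i + 1 < n → ε ≤ |⟪‖g i (v i)‖⁻¹ • (g i (v i)), v (i + 1)⟫|) →
    |Real.log ‖chainProd g n‖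
        + (∑ i ∈ Finset.Icc 1 (n - 2), Real.log ‖g i‖)
        - ∑ i ∈ Finset.range (n - 1), Real.log ‖(g (i + 1)).comp (g i)‖|
      ≤ C * n * κ / ε ^ 2 := by
  refine ⟨1 / 8, by norm_num, 12, by norm_num, ?_⟩
  intro m n _ hn ε κ hε hε1 hκ hκε g v hg hv hα
  obtain ⟨k, rfl⟩ : ∃ k, n = k + 2 := ⟨n - 2, by omega⟩
  have h1 := av_norm g v (k + 2) ε κ hε hε1 hκ hκε hg hv hα (k + 1) (by omega)
  have h2 : ∀ i ∈ Finset.range (k + 1), |Real.log ‖(g (i + 1)).comp (g i)‖ - (Real.log ‖g i‖ +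
      (Real.log ‖g (i + 1)‖ + Real.log |⟪‖g i (v i)‖⁻¹ • (g i (v i)), v (i + 1)⟫|))|
      ≤ 2 * (4 * κ / ε ^ 2) := by
    intro i hi
    have hi' := Finset.mem_range.1 hi
    have := av_norm (fun j => g (j + i)) (fun j => v (j + i)) 2 ε κ hε hε1 hκ hκε
      (fun j hj => hg _ (by omega)) (fun j hj => hv _ (by omega))
      (fun j hj => by
        have := hα (j + i) (by omega)
        rwa [show j + i + 1 = j + 1 + i by omega] at this) 1 (by norm_num)
    simp only [Finset.range_one, Finset.sum_singleton, zero_add, chainProd,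
      ContinuousLinearMap.comp_id, add_comm 1 i] at this
    norm_num at this ⊢
    exact this
  have h3 : |∑ i ∈ Finset.range (k + 1), (Real.log ‖(g (i + 1)).comp (g i)‖ - (Real.log ‖g i‖ +
      (Real.log ‖g (i + 1)‖ + Real.log |⟪‖g i (v i)‖⁻¹ • (g i (v i)), v (i + 1)⟫|)))|
      ≤ (k + 1) * (2 * (4 * κ / ε ^ 2)) := by
    refine (Finset.abs_sum_le_sum_abs _ _).trans ((Finset.sum_le_sum h2).trans ?_)
    simp
  have h4 : ∑ i ∈ Finset.Icc 1 k, Real.log ‖g i‖ =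
      ∑ i ∈ Finset.range k, Real.log ‖g (i + 1)‖ := by
    rw [Finset.range_eq_Ico, Finset.sum_Ico_add' (fun i => Real.log ‖g i‖) 0 k 1]
    rfl
  have h5 : ∑ i ∈ Finset.range (k + 1), Real.log ‖g i‖ =
      ∑ i ∈ Finset.range k, Real.log ‖g (i + 1)‖ + Real.log ‖g 0‖ := Finset.sum_range_succ' _ _
  rw [Finset.sum_sub_distrib, Finset.sum_add_distrib, h5] at h3
  simp only [Nat.add_sub_cancel, show k + 2 - 1 = k + 1 by omega]
  rw [h4]
  have h6 : 12 * ((k + 2 : ℕ) : ℝ) * κ / ε ^ 2 = 3 * (k + 2) * (4 * κ / ε ^ 2) := by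
    push_cast; ring
  rw [h6]
  have h7 : 0 < 4 * κ / ε ^ 2 := by positivity
  generalize 4 * κ / ε ^ 2 = η at *
  push_cast at h1
  rw [abs_le] at *
  constructor <;> linarith
end

section
/- (Avalanche Principle, most expanding directions.) There exist universal constants c > 0 and C > 0 such that: for every m ≥ 1, every n ≥ 1, all 0 < ε < 1 and 0 < κ ≤ c·ε², and every chain of nonzero linear maps g₀, g₁, …, g_{n−1} on ℝ^m (with its Euclidean inner product) such that each g_i admits a κ-gap most expanding direction v_i and |⟨g_{i−1} v_{i−1}/‖g_{i−1} v_{i−1}‖, v_i⟩| ≥ ε for all 1 ≤ i ≤ n−1, the product G := g_{n−1} ⋯ g₁ g₀ is nonzero and every unit vector u with ‖G u‖ = ‖G‖ satisfies: (1) min{‖u − v₀‖, ‖u + v₀‖} ≤ C·κ/ε; and (2) min{‖u* − v*‖, ‖u* + v*‖} ≤ C·κ/ε, where u* := G u/‖G u‖ and v* := g_{n−1} v_{n−1}/‖g_{n−1} v_{n−1}‖. -/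
open RealInnerProductSpace

lemma chainProd_succ_front {V : Type*} [NormedAddCommGroup V] [InnerProductSpace ℝ V]
    (g : ℕ → V →L[ℝ] V) (n : ℕ) (x : V) :
    chainProd g (n + 1) x = chainProd (fun i => g (i + 1)) n (g 0 x) := by
  induction n with
  | zero => simp [chainProd]
  | succ k ih =>
    have h1 : chainProd g (k + 1 + 1) x = g (k + 1) (chainProd g (k + 1) x) := rfl
    rw [h1, ih]; rfl

/-- The hypotheses on one map. -/
def Gap {V : Type*} [NormedAddCommGroup V] [InnerProductSpace ℝ V] (κ : ℝ)
    (g : V →L[ℝ] V) (v : V) : Prop :=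
  ‖v‖ = 1 ∧ ‖g v‖ = ‖g‖ ∧ ∀ w, ⟪v, w⟫ = 0 → ‖g w‖ ≤ κ * ‖g‖ * ‖w‖

lemma decomp {V : Type*} [NormedAddCommGroup V] [InnerProductSpace ℝ V]
    (v x : V) (hv : ‖v‖ = 1) :
    ∃ w, x = ⟪x, v⟫ • v + w ∧ ⟪v, w⟫ = 0 ∧ ‖x‖ ^ 2 = ⟪x, v⟫ ^ 2 + ‖w‖ ^ 2 := by
  refine ⟨x - ⟪x, v⟫ • v, by abel, ?_, ?_⟩
  · rw [inner_sub_right, inner_smul_right, real_inner_self_eq_norm_sq, hv,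
      real_inner_comm]; ring
  · rw [norm_sub_sq_real, inner_smul_right, norm_smul, hv, Real.norm_eq_abs, mul_one, sq_abs]; ring

lemma gap_step {V : Type*} [NormedAddCommGroup V] [InnerProductSpace ℝ V] {κ : ℝ} (hκ : 0 < κ)
    {g : V →L[ℝ] V} {v : V} (h : Gap κ g v) (hg : g ≠ 0) (x : V) :
    ∃ r, g x = (⟪x, v⟫ * ‖g‖) • (‖g v‖⁻¹ • g v) + r ∧ ‖r‖ ≤ κ * ‖g‖ * ‖x‖ := by
  obtain ⟨hv, hgv, hw⟩ := h
  obtain ⟨w, hx, hvw, hn⟩ := decomp v x hv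
  have hpos : 0 < ‖g‖ := norm_pos_iff.mpr hg
  refine ⟨g w, ?_, ?_⟩
  · conv_lhs => rw [hx]
    rw [map_add, map_smul, smul_smul, hgv, mul_assoc, mul_inv_cancel₀ hpos.ne', mul_one]
  · refine (hw w hvw).trans ?_
    have : ‖w‖ ≤ ‖x‖ := by
      refine (sq_le_sq₀ (norm_nonneg w) (norm_nonneg x)).mp ?_
      nlinarith [sq_nonneg ⟪x, v⟫]
    gcongr

lemma norm_dir {V : Type*} [NormedAddCommGroup V] [InnerProductSpace ℝ V] {κ : ℝ}
    {g : V →L[ℝ] V} {v : V} (h : Gap κ g v) (hg : g ≠ 0) : ‖‖g v‖⁻¹ • g v‖ = 1 := by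
  have hpos : 0 < ‖g‖ := norm_pos_iff.mpr hg
  rw [norm_smul, norm_inv, norm_norm, h.2.1, inv_mul_cancel₀ hpos.ne']

lemma chain_comparison {V : Type*} [NormedAddCommGroup V] [InnerProductSpace ℝ V] {ε κ : ℝ}
    (hε : 0 < ε) (hε1 : ε < 1) (hκ : 0 < κ) (hκε : κ ≤ 1 / 8 * ε ^ 2) (n : ℕ) :
    ∀ (g : ℕ → V →L[ℝ] V) (v : ℕ → V), (∀ i < n, g i ≠ 0) → (∀ i < n, Gap κ (g i) (v i)) →
    (∀ i, i + 1 < n → ε ≤ |⟪‖g i (v i)‖⁻¹ • (g i (v i)), v (i + 1)⟫|) →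
    ∀ x, ‖x‖ = 1 → (0 < n → ε ≤ |⟪x, v 0⟫|) →
      0 < ‖chainProd g n x‖ ∧
        ∀ y, ‖chainProd g n y‖ ≤ (2 / ε) * ‖chainProd g n x‖ * ‖y‖ := by
  induction n with
  | zero =>
    intro g v _ _ _ x hx _
    have h2 : 1 ≤ 2 / ε := by rw [le_div_iff₀ hε]; linarith
    simp only [chainProd, ContinuousLinearMap.id_apply, hx]
    refine ⟨one_pos, fun y => ?_⟩
    nlinarith [norm_nonneg y]
  | succ n ih =>
    intro g v hg0 hgap hang x hx hxv
    have hxv := hxv n.succ_pos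
    have G0 := hgap 0 n.succ_pos
    have N0 := hg0 0 n.succ_pos
    have hpos : 0 < ‖g 0‖ := norm_pos_iff.mpr N0
    obtain ⟨he, hb⟩ := ih (fun i => g (i + 1)) (fun i => v (i + 1))
      (fun i hi => hg0 (i + 1) (by omega)) (fun i hi => hgap (i + 1) (by omega))
      (fun i hi => hang (i + 1) (by omega)) _ (norm_dir G0 N0) (fun hn => hang 0 (by omega))
    set e := ‖g 0 (v 0)‖⁻¹ • g 0 (v 0) with he_def
    set H := chainProd (fun i => g (i + 1)) n with hH
    set q := κ * (2 / ε) with hq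
    have hq4 : q ≤ ε / 4 := by
      rw [hq, ← mul_div_assoc, div_le_iff₀ hε]; nlinarith
    have hq0 : 0 < q := by positivity
    have key : ∀ y, ∃ s, H (g 0 y) = (⟪y, v 0⟫ * ‖g 0‖) • H e + s ∧
        ‖s‖ ≤ q * (‖g 0‖ * ‖H e‖) * ‖y‖ := by
      intro y
      obtain ⟨r, hr, hrn⟩ := gap_step hκ G0 N0 y
      refine ⟨H r, by rw [hr, map_add, map_smul], (hb r).trans ?_⟩
      calc 2 / ε * ‖H e‖ * ‖r‖ ≤ 2 / ε * ‖H e‖ * (κ * ‖g 0‖ * ‖y‖) := by gcongr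
        _ = _ := by rw [hq]; ring
    have hM : 0 < ‖g 0‖ * ‖H e‖ := mul_pos hpos he
    have low : (ε - q) * (‖g 0‖ * ‖H e‖) ≤ ‖H (g 0 x)‖ := by
      obtain ⟨s, hs, hsn⟩ := key x
      have h1 : ‖(⟪x, v 0⟫ * ‖g 0‖) • H e‖ ≤ ‖H (g 0 x)‖ + ‖s‖ := by
        have : (⟪x, v 0⟫ * ‖g 0‖) • H e = H (g 0 x) - s := by rw [hs]; abel
        rw [this]; exact norm_sub_le _ _
      rw [norm_smul, norm_mul, norm_norm, Real.norm_eq_abs] at h1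
      rw [hx] at hsn
      nlinarith
    have hup : ∀ y, ‖H (g 0 y)‖ ≤ (1 + q) * (‖g 0‖ * ‖H e‖) * ‖y‖ := by
      intro y
      obtain ⟨s, hs, hsn⟩ := key y
      have h1 := norm_add_le ((⟪y, v 0⟫ * ‖g 0‖) • H e) s
      rw [← hs, norm_smul, norm_mul, norm_norm, Real.norm_eq_abs] at h1
      have h2 := abs_real_inner_le_norm y (v 0)
      rw [G0.1, mul_one] at h2
      nlinarith
    simp only [chainProd_succ_front, ← hH]
    refine ⟨lt_of_lt_of_le (mul_pos (by linarith) hM) low, fun y => (hup y).trans ?_⟩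
    refine mul_le_mul_of_nonneg_right ?_ (norm_nonneg y)
    calc (1 + q) * (‖g 0‖ * ‖H e‖) ≤ (2 / ε * (ε - q)) * (‖g 0‖ * ‖H e‖) := by
          refine mul_le_mul_of_nonneg_right ?_ hM.le
          rw [div_mul_eq_mul_div, le_div_iff₀ hε]; nlinarith
      _ = 2 / ε * ((ε - q) * (‖g 0‖ * ‖H e‖)) := by ring
      _ ≤ _ := by gcongr

lemma cone {V : Type*} [NormedAddCommGroup V] [InnerProductSpace ℝ V] {ε κ : ℝ}
    (hε : 0 < ε) (hε1 : ε < 1) (hκ : 0 < κ) (hκε : κ ≤ 1 / 8 * ε ^ 2) (n : ℕ)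
    (g : ℕ → V →L[ℝ] V) (v : ℕ → V) (hg0 : ∀ i < n, g i ≠ 0) (hgap : ∀ i < n, Gap κ (g i) (v i))
    (hang : ∀ i, i + 1 < n → ε ≤ |⟪‖g i (v i)‖⁻¹ • (g i (v i)), v (i + 1)⟫|)
    (x : V) (hx : ε / 2 * ‖x‖ ≤ |⟪x, v 0⟫|) (k : ℕ) (hk : k < n) :
    ε / 2 * ‖chainProd g k x‖ ≤ |⟪chainProd g k x, v k⟫| := by
  induction k with
  | zero => simpa [chainProd] using hx
  | succ k ih =>
    have ih := ih (by omega)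
    have Gk := hgap k (by omega)
    have Nk := hg0 k (by omega)
    have hpos : 0 < ‖g k‖ := norm_pos_iff.mpr Nk
    have hrw : chainProd g (k + 1) x = g k (chainProd g k x) := rfl
    rw [hrw]
    set z := chainProd g k x
    obtain ⟨r, hr, hrn⟩ := gap_step hκ Gk Nk z
    have ha := hang k hk
    have he := norm_dir Gk Nk
    set e := ‖g k (v k)‖⁻¹ • g k (v k)
    have h1 : ‖g k z‖ ≤ |⟪z, v k⟫| * ‖g k‖ + ‖r‖ := by
      rw [hr]; refine (norm_add_le _ _).trans ?_
      rw [norm_smul, he, norm_mul, norm_norm, Real.norm_eq_abs, mul_one]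
    have h2 : |⟪z, v k⟫| * ‖g k‖ * |⟪e, v (k + 1)⟫| - ‖r‖ ≤ |⟪g k z, v (k + 1)⟫| := by
      have h3 := abs_real_inner_le_norm r (v (k + 1))
      rw [(hgap (k + 1) hk).1, mul_one] at h3
      have h4 : ⟪z, v k⟫ * ‖g k‖ * ⟪e, v (k + 1)⟫ = ⟪g k z, v (k + 1)⟫ - ⟪r, v (k + 1)⟫ := by
        rw [hr, inner_add_left, real_inner_smul_left e, add_sub_cancel_right]
      have h5 := abs_sub (⟪g k z, v (k + 1)⟫) (⟪r, v (k + 1)⟫)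
      rw [← h4, abs_mul, abs_mul, abs_norm] at h5
      linarith
    have hA : 0 ≤ |⟪z, v k⟫| * ‖g k‖ := by positivity
    have h6 := mul_le_mul_of_nonneg_left ha hA
    have h7 : ε / 2 * ‖z‖ * ‖g k‖ ≤ |⟪z, v k⟫| * ‖g k‖ := by gcongr
    have hZ : 0 ≤ ‖g k‖ * ‖z‖ := by positivity
    have h8 : ‖r‖ ≤ ε / 4 * (|⟪z, v k⟫| * ‖g k‖) := by
      calc ‖r‖ ≤ κ * (‖g k‖ * ‖z‖) := by linarith
        _ ≤ 1 / 8 * ε ^ 2 * (‖g k‖ * ‖z‖) := by gcongr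
        _ = ε / 4 * (ε / 2 * ‖z‖ * ‖g k‖) := by ring
        _ ≤ _ := by gcongr
    have h9 : ε / 2 * ‖g k z‖ ≤ ε / 2 * (|⟪z, v k⟫| * ‖g k‖ + ‖r‖) := by gcongr
    nlinarith [norm_nonneg r]

/-- Directions of `t • e + r` and `e` are close. -/
lemma dir_close {V : Type*} [NormedAddCommGroup V] [InnerProductSpace ℝ V] (e r : V) (t δ : ℝ)
    (he : ‖e‖ = 1) (ht : 0 < |t|) (hr : ‖r‖ ≤ δ * |t|) (hz : 0 < ‖t • e + r‖) :
    min ‖‖t • e + r‖⁻¹ • (t • e + r) - e‖ ‖‖t • e + r‖⁻¹ • (t • e + r) + e‖ ≤ 2 * δ := by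
  have main : ∀ (t : ℝ) (r : V), 0 < t → ‖r‖ ≤ δ * t → 0 < ‖t • e + r‖ →
      ‖‖t • e + r‖⁻¹ • (t • e + r) - e‖ ≤ 2 * δ := by
    intro t r ht hr hz
    set y := t • e + r with hy
    have h1 : t • (‖y‖⁻¹ • y - e) = ((t - ‖y‖) * ‖y‖⁻¹) • y + r := by
      rw [sub_mul, mul_inv_cancel₀ hz.ne', sub_smul, one_smul, smul_sub, smul_smul]
      nth_rewrite 5 [hy]; abel
    have h2 : |t - ‖y‖| ≤ ‖r‖ := by
      have := abs_norm_sub_norm_le (t • e) y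
      rw [norm_smul, he, mul_one, Real.norm_eq_abs, abs_of_pos ht] at this
      refine this.trans (le_of_eq ?_)
      rw [hy, ← norm_neg]; congr 1; abel
    have h3 : t * ‖‖y‖⁻¹ • y - e‖ ≤ t * (2 * δ) := by
      calc t * ‖‖y‖⁻¹ • y - e‖ = ‖t • (‖y‖⁻¹ • y - e)‖ := by
            rw [norm_smul, Real.norm_eq_abs, abs_of_pos ht]
        _ ≤ ‖((t - ‖y‖) * ‖y‖⁻¹) • y‖ + ‖r‖ := by rw [h1]; exact norm_add_le _ _
        _ = |t - ‖y‖| + ‖r‖ := by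
            rw [norm_smul, norm_mul, norm_inv, norm_norm, mul_assoc, inv_mul_cancel₀ hz.ne',
              mul_one, Real.norm_eq_abs]
        _ ≤ _ := by linarith
    exact le_of_mul_le_mul_left h3 ht
  rcases lt_or_gt_of_ne (abs_pos.mp ht) with h | h
  · rw [abs_of_neg h] at hr
    have hneg : (-t) • e + -r = -(t • e + r) := by rw [neg_smul, neg_add]
    have := main (-t) (-r) (by linarith) (by rwa [norm_neg]) (by rwa [hneg, norm_neg])
    rw [hneg, norm_neg, smul_neg, ← neg_add', norm_neg] at this
    exact (min_le_right _ _).trans this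
  · rw [abs_of_pos h] at hr
    exact (min_le_left _ _).trans (main t r h hr hz)

/-- **Avalanche Principle, most expanding directions.** -/
theorem avalanche_principle_directions :
    ∃ c > (0:ℝ), ∃ C > (0:ℝ), ∀ (m n : ℕ), 1 ≤ m → 1 ≤ n →
    ∀ ε κ : ℝ, 0 < ε → ε < 1 → 0 < κ → κ ≤ c * ε ^ 2 →
    ∀ g : ℕ → (EuclideanSpace ℝ (Fin m) →L[ℝ] EuclideanSpace ℝ (Fin m)),
    ∀ v : ℕ → EuclideanSpace ℝ (Fin m),
    (∀ i < n, g i ≠ 0) →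
    (∀ i < n, ‖v i‖ = 1 ∧ ‖g i (v i)‖ = ‖g i‖ ∧
      ∀ w, ⟪v i, w⟫ = 0 → ‖g i w‖ ≤ κ * ‖g i‖ * ‖w‖) →
    (∀ i, i + 1 < n → ε ≤ |⟪‖g i (v i)‖⁻¹ • (g i (v i)), v (i + 1)⟫|) →
    chainProd g n ≠ 0 ∧
    ∀ u : EuclideanSpace ℝ (Fin m), ‖u‖ = 1 → ‖chainProd g n u‖ = ‖chainProd g n‖ →
      min ‖u - v 0‖ ‖u + v 0‖ ≤ C * κ / ε ∧
      min ‖‖chainProd g n u‖⁻¹ • (chainProd g n u)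
              - ‖g (n - 1) (v (n - 1))‖⁻¹ • (g (n - 1) (v (n - 1)))‖
          ‖‖chainProd g n u‖⁻¹ • (chainProd g n u)
              + ‖g (n - 1) (v (n - 1))‖⁻¹ • (g (n - 1) (v (n - 1)))‖
        ≤ C * κ / ε := by
  refine ⟨1 / 8, by norm_num, 8, by norm_num, ?_⟩
  intro m n _ hn ε κ hε hε1 hκ hκε g v hg0 hgap0 hang
  have hgap : ∀ i < n, Gap κ (g i) (v i) := hgap0
  obtain ⟨p, rfl⟩ : ∃ p, n = p + 1 := ⟨n - 1, by omega⟩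
  have G0 := hgap 0 p.succ_pos
  have N0 := hg0 0 p.succ_pos
  have hpos : 0 < ‖g 0‖ := norm_pos_iff.mpr N0
  have hv0 := G0.1
  obtain ⟨hGv, -⟩ := chain_comparison hε hε1 hκ hκε (p + 1) g v hg0 hgap hang (v 0) hv0
    (fun _ => by rw [real_inner_self_eq_norm_sq, hv0]; norm_num; exact hε1.le)
  obtain ⟨-, hb⟩ := chain_comparison hε hε1 hκ hκε p (fun i => g (i + 1)) (fun i => v (i + 1))
      (fun i hi => hg0 (i + 1) (by omega)) (fun i hi => hgap (i + 1) (by omega))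
      (fun i hi => hang (i + 1) (by omega)) _ (norm_dir G0 N0) (fun hn => hang 0 (by omega))
  refine ⟨fun h => by simp [h] at hGv, ?_⟩
  intro u hu humax
  obtain ⟨q, hq⟩ : ∃ q, q = κ / ε := ⟨_, rfl⟩
  have hq0 : 0 < q := by rw [hq]; positivity
  have hq8 : q ≤ ε / 8 := by rw [hq, div_le_iff₀ hε]; nlinarith
  have hC : 8 * κ / ε = 8 * q := by rw [hq]; ring
  rw [hC]
  have hGu : 0 < ‖chainProd g (p + 1) u‖ := by
    rw [humax, norm_pos_iff]; exact fun h => by simp [h] at hGv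
  obtain ⟨w, hw, hvw, hnw⟩ := decomp (v 0) u hv0
  have hGw : ‖chainProd g (p + 1) w‖ ≤ 2 * q * ‖w‖ * ‖chainProd g (p + 1) (v 0)‖ := by
    rw [chainProd_succ_front, chainProd_succ_front]
    refine (hb _).trans ?_
    rw [map_smul, norm_smul, norm_inv, norm_norm, G0.2.1]
    calc _ ≤ 2 / ε * (‖g 0‖⁻¹ * ‖chainProd (fun i => g (i + 1)) p (g 0 (v 0))‖)
            * (κ * ‖g 0‖ * ‖w‖) := by
          gcongr; exact G0.2.2 w hvw
      _ = _ := by rw [hq]; field_simp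
  set a := ⟪u, v 0⟫ with ha
  have h1 : ‖chainProd g (p + 1) (v 0)‖ ≤ ‖chainProd g (p + 1) u‖ := by
    rw [humax]; simpa [hv0] using (chainProd g (p + 1)).le_opNorm (v 0)
  have h2 : ‖chainProd g (p + 1) u‖ ≤ (|a| + 2 * q * ‖w‖) * ‖chainProd g (p + 1) (v 0)‖ := by
    conv_lhs => rw [hw]
    rw [map_add, map_smul]
    refine (norm_add_le _ _).trans ?_
    rw [norm_smul, Real.norm_eq_abs]; linarith
  have h3 : 1 ≤ |a| + 2 * q * ‖w‖ := by
    refine le_of_mul_le_mul_right ?_ hGv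
    linarith
  rw [hu, ← sq_abs a] at hnw
  have hw0 := norm_nonneg w
  have ha0 := abs_nonneg a
  have ha1 : |a| ≤ 1 := by nlinarith
  have hw1 : ‖w‖ ≤ 1 := by nlinarith
  have hw4 : ‖w‖ ≤ 4 * q := by
    by_contra hcon
    push Not at hcon
    nlinarith
  have ha2 : 1 - |a| ≤ 2 * q := by nlinarith
  refine ⟨?_, ?_⟩
  · rcases le_total 0 a with h | h
    · rw [abs_of_nonneg h] at *
      refine (min_le_left _ _).trans ?_
      have : u - v 0 = w - (1 - a) • v 0 := by
        conv_lhs => rw [hw]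
        rw [sub_smul, one_smul]; abel
      rw [this]
      refine (norm_sub_le _ _).trans ?_
      rw [norm_smul, hv0, Real.norm_eq_abs, abs_of_nonneg (by linarith)]
      linarith
    · rw [abs_of_nonpos h] at *
      refine (min_le_right _ _).trans ?_
      have : u + v 0 = w + (1 + a) • v 0 := by
        conv_lhs => rw [hw]
        rw [add_smul, one_smul]; abel
      rw [this]
      refine (norm_add_le _ _).trans ?_
      rw [norm_smul, hv0, Real.norm_eq_abs, abs_of_nonneg (by linarith)]
      linarith
  · have hc := cone hε hε1 hκ hκε (p + 1) g v hg0 hgap hang u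
      (by rw [hu, ← ha]; linarith) p (by omega)
    have Np := hg0 p (by omega)
    have Gp := hgap p (by omega)
    have hpp : 0 < ‖g p‖ := norm_pos_iff.mpr Np
    have hrw : chainProd g (p + 1) u = g p (chainProd g p u) := rfl
    rw [Nat.add_sub_cancel]
    rw [hrw] at hGu ⊢
    set z := chainProd g p u
    have hz : 0 < ‖z‖ := norm_pos_iff.mpr (fun h => by simp [h] at hGu)
    obtain ⟨r, hr, hrn⟩ := gap_step hκ Gp Np z
    rw [hr] at hGu ⊢
    have hin : 0 < |⟪z, v p⟫| := lt_of_lt_of_le (by positivity) hc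
    have := dir_close _ r (⟪z, v p⟫ * ‖g p‖) (2 * q) (norm_dir Gp Np)
      (by rw [abs_mul, abs_norm]; positivity) (by
        rw [abs_mul, abs_norm]
        calc ‖r‖ ≤ κ * ‖g p‖ * ‖z‖ := hrn
          _ = 2 * q * (ε / 2 * ‖z‖ * ‖g p‖) := by rw [hq]; field_simp
          _ ≤ _ := by gcongr) hGu
    linarith
end

section
/- (Avalanche Principle, gap of the product.) There exists a universal constant c > 0 such that: for every m ≥ 1, every n ≥ 1, all 0 < ε < 1 and 0 < κ ≤ c·ε², and every chain of nonzero linear maps g₀, g₁, …, g_{n−1} on ℝ^m (with its Euclidean inner product) such that each g_i admits a κ-gap most expanding direction v_i and |⟨g_{i−1} v_{i−1}/‖g_{i−1} v_{i−1}‖, v_i⟩| ≥ ε for all 1 ≤ i ≤ n−1, the product G := g_{n−1} ⋯ g₁ g₀ is nonzero and there exists a unit vector u with ‖G u‖ = ‖G‖ such that ‖G w‖ ≤ (κ·(4 + 2ε)/ε²)^n · ‖G‖ · ‖w‖ for every w orthogonal to u; that is, the ratio of the second to first singular values of G is at most (κ·(4 + 2ε)/ε²)^n. -/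
open RealInnerProductSpace

section helpers

variable {V : Type*} [NormedAddCommGroup V] [InnerProductSpace ℝ V]

/-- The Gram determinant of two vectors. -/
noncomputable def gram2 (x y : V) : ℝ := ‖x‖ ^ 2 * ‖y‖ ^ 2 - ⟪x, y⟫ ^ 2

theorem gram2_comm (x y : V) : gram2 x y = gram2 y x := by
  unfold gram2; rw [real_inner_comm]; ring

theorem gram2_sub_smul (x y : V) (t : ℝ) : gram2 x (y - t • x) = gram2 x y := by
  unfold gram2
  rw [← real_inner_self_eq_norm_sq, ← real_inner_self_eq_norm_sq, ← real_inner_self_eq_norm_sq]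
  simp only [inner_sub_left, inner_sub_right, real_inner_smul_left, real_inner_smul_right]
  rw [real_inner_comm x y]
  ring

theorem gram2_map_aux (g : V →L[ℝ] V) (v : V) (κ : ℝ) (hκ : 0 < κ)
    (h : ∀ w, ⟪v, w⟫ = 0 → ‖g w‖ ≤ κ * ‖g‖ * ‖w‖) (p q : V) (hp : ⟪v, p⟫ = 0) :
    gram2 (g p) (g q) ≤ κ ^ 2 * ‖g‖ ^ 4 * gram2 p q := by
  by_cases hp0 : p = 0
  · subst hp0; simp [gram2]
  have hpp : ‖p‖ ^ 2 ≠ 0 := by simpa using hp0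
  set t : ℝ := ⟪p, q⟫ / ‖p‖ ^ 2 with ht
  have horth : ⟪p, q - t • p⟫ = 0 := by
    rw [inner_sub_right, real_inner_smul_right, real_inner_self_eq_norm_sq, ht]
    field_simp; ring
  have e1 : gram2 (g p) (g q) = gram2 (g p) (g (q - t • p)) := by
    rw [map_sub, map_smul, gram2_sub_smul]
  rw [e1, ← gram2_sub_smul p q t]
  have h1 := h p hp
  have h2 := g.le_opNorm (q - t • p)
  have h3 : gram2 p (q - t • p) = ‖p‖ ^ 2 * ‖q - t • p‖ ^ 2 := by
    unfold gram2; rw [horth]; ring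
  rw [h3]
  calc gram2 (g p) (g (q - t • p)) ≤ ‖g p‖ ^ 2 * ‖g (q - t • p)‖ ^ 2 := by
        unfold gram2; nlinarith [sq_nonneg ⟪g p, g (q - t • p)⟫]
    _ ≤ (κ * ‖g‖ * ‖p‖) ^ 2 * (‖g‖ * ‖q - t • p‖) ^ 2 := by gcongr
    _ = _ := by ring

theorem gram2_map (g : V →L[ℝ] V) (v : V) (κ : ℝ) (hκ : 0 < κ)
    (h : ∀ w, ⟪v, w⟫ = 0 → ‖g w‖ ≤ κ * ‖g‖ * ‖w‖) (x y : V) :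
    gram2 (g x) (g y) ≤ κ ^ 2 * ‖g‖ ^ 4 * gram2 x y := by
  by_cases ha : ⟪v, x⟫ = 0
  · exact gram2_map_aux g v κ hκ h x y ha
  set t : ℝ := ⟪v, y⟫ / ⟪v, x⟫ with ht
  have horth : ⟪v, y - t • x⟫ = 0 := by
    rw [inner_sub_right, real_inner_smul_right, ht]
    field_simp; ring
  have := gram2_map_aux g v κ hκ h (y - t • x) x horth
  rwa [gram2_comm, gram2_comm (y - t • x), map_sub, map_smul, gram2_sub_smul,
    gram2_sub_smul] at this

theorem gram2_chain (g : ℕ → V →L[ℝ] V) (v : ℕ → V) (κ : ℝ) (hκ : 0 < κ) (n : ℕ)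
    (h : ∀ i < n, ∀ w, ⟪v i, w⟫ = 0 → ‖g i w‖ ≤ κ * ‖g i‖ * ‖w‖) (x y : V) :
    gram2 (chainProd g n x) (chainProd g n y)
      ≤ (κ ^ n) ^ 2 * (∏ i ∈ Finset.range n, ‖g i‖) ^ 4 * gram2 x y := by
  induction n with
  | zero => simp [chainProd]
  | succ n ih =>
    have ih' := ih (fun i hi => h i (by omega))
    have h1 := gram2_map (g n) (v n) κ hκ (h n (by omega)) (chainProd g n x) (chainProd g n y)
    rw [Finset.prod_range_succ]
    calc _ ≤ κ ^ 2 * ‖g n‖ ^ 4 * gram2 (chainProd g n x) (chainProd g n y) := h1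
      _ ≤ κ ^ 2 * ‖g n‖ ^ 4 *
          ((κ ^ n) ^ 2 * (∏ i ∈ Finset.range n, ‖g i‖) ^ 4 * gram2 x y) := by gcongr
      _ = _ := by ring

/-- One step, upper/lower bounds for the image of a vector. -/
theorem step_err (g : V →L[ℝ] V) (v : V) (κ : ℝ) (hκ : 0 < κ) (hv : ‖v‖ = 1)
    (h : ∀ w, ⟪v, w⟫ = 0 → ‖g w‖ ≤ κ * ‖g‖ * ‖w‖) (x : V) :
    ‖g x - ⟪v, x⟫ • g v‖ ≤ κ * ‖g‖ * ‖x‖ := by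
  have horth : ⟪v, x - ⟪v, x⟫ • v⟫ = 0 := by
    rw [inner_sub_right, real_inner_smul_right, real_inner_self_eq_norm_sq, hv]; ring
  have h1 := h _ horth
  have h2 : ‖x - ⟪v, x⟫ • v‖ ≤ ‖x‖ := by
    apply le_of_sq_le_sq _ (norm_nonneg _)
    rw [← real_inner_self_eq_norm_sq, inner_sub_left, real_inner_smul_left, horth,
      inner_sub_right, real_inner_smul_right, real_inner_self_eq_norm_sq, real_inner_comm v x]
    nlinarith [sq_nonneg ⟪v, x⟫]
  rw [map_sub, map_smul] at h1
  exact h1.trans (by gcongr)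

theorem step_norm (g : V →L[ℝ] V) (v : V) (κ ε : ℝ) (hκ : 0 < κ) (hε : 0 < ε) (hε1 : ε < 1)
    (hk : κ ≤ 1 / 16 * ε ^ 2) (hv : ‖v‖ = 1) (hgv : ‖g v‖ = ‖g‖)
    (h : ∀ w, ⟪v, w⟫ = 0 → ‖g w‖ ≤ κ * ‖g‖ * ‖w‖) (x : V)
    (hx : 3 / 4 * ε * ‖x‖ ≤ |⟪v, x⟫|) :
    ε / 2 * ‖g‖ * ‖x‖ ≤ ‖g x‖ := by
  have h1 := step_err g v κ hκ hv h x
  have h2 : ‖⟪v, x⟫ • g v‖ ≤ ‖g x‖ + ‖g x - ⟪v, x⟫ • g v‖ := by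
    have := norm_sub_le (g x) (g x - ⟪v, x⟫ • g v)
    simpa using this
  rw [norm_smul, hgv, Real.norm_eq_abs] at h2
  have h3 : 3 / 4 * ε * ‖x‖ * ‖g‖ ≤ |⟪v, x⟫| * ‖g‖ := by gcongr
  have h4 : κ * (‖g‖ * ‖x‖) ≤ ε / 4 * (‖g‖ * ‖x‖) := by
    gcongr; nlinarith
  nlinarith

theorem step_cone (g : V →L[ℝ] V) (v v' : V) (κ ε : ℝ) (hκ : 0 < κ) (hε : 0 < ε) (hε1 : ε < 1)
    (hk : κ ≤ 1 / 16 * ε ^ 2) (hv : ‖v‖ = 1) (hv' : ‖v'‖ = 1) (hgv : ‖g v‖ = ‖g‖)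
    (h : ∀ w, ⟪v, w⟫ = 0 → ‖g w‖ ≤ κ * ‖g‖ * ‖w‖)
    (ha : ε * ‖g‖ ≤ |⟪v', g v⟫|) (x : V)
    (hx : 3 / 4 * ε * ‖x‖ ≤ |⟪v, x⟫|) :
    3 / 4 * ε * ‖g x‖ ≤ |⟪v', g x⟫| := by
  have h1 := step_err g v κ hκ hv h x
  set a := ⟪v, x⟫ with hadef
  have h2 : ‖g x‖ ≤ |a| * ‖g‖ + κ * ‖g‖ * ‖x‖ := by
    have := norm_add_le (g x - a • g v) (a • g v)
    rw [sub_add_cancel, norm_smul, hgv, Real.norm_eq_abs] at this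
    linarith
  have h3 : |a| * |⟪v', g v⟫| ≤ |⟪v', g x⟫| + κ * ‖g‖ * ‖x‖ := by
    have e : a * ⟪v', g v⟫ = ⟪v', g x⟫ - ⟪v', g x - a • g v⟫ := by
      rw [inner_sub_right, real_inner_smul_right]; ring
    have h5 := abs_real_inner_le_norm v' (g x - a • g v)
    rw [hv', one_mul] at h5
    rw [← abs_mul, e]
    have := abs_sub ⟪v', g x⟫ ⟪v', g x - a • g v⟫
    linarith
  have h4 : |a| * (ε * ‖g‖) ≤ |a| * |⟪v', g v⟫| := by gcongr
  have h5 : ε * (3 / 4 * ε * ‖x‖ * ‖g‖) ≤ ε * (|a| * ‖g‖) := by gcongr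
  have h6 : κ * (‖g‖ * ‖x‖) ≤ 1 / 16 * ε ^ 2 * (‖g‖ * ‖x‖) := by gcongr
  have h7 : 3 / 4 * ε * ‖g x‖ ≤ 3 / 4 * ε * (|a| * ‖g‖ + κ * ‖g‖ * ‖x‖) := by gcongr
  have h8 : ε * (κ * (‖g‖ * ‖x‖)) ≤ 1 * (κ * (‖g‖ * ‖x‖)) := by gcongr
  have h9 : 0 ≤ ε ^ 2 * (‖g‖ * ‖x‖) := by positivity
  nlinarith

theorem top_orth (G : V →L[ℝ] V) (u : V) (hu : ‖u‖ = 1) (hG : ‖G u‖ = ‖G‖) (w : V)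
    (hw : ⟪u, w⟫ = 0) : ⟪G u, G w⟫ = 0 := by
  have key : ∀ t : ℝ, 2 * t * ⟪G u, G w⟫ ≤ t ^ 2 * (‖G‖ ^ 2 * ‖w‖ ^ 2) := by
    intro t
    have h1 := G.le_opNorm (u + t • w)
    have h2 : ‖G (u + t • w)‖ ^ 2 ≤ (‖G‖ * ‖u + t • w‖) ^ 2 := by gcongr
    rw [mul_pow, map_add, map_smul, norm_add_sq_real, norm_add_sq_real, hu, hG,
      real_inner_smul_right, real_inner_smul_right, hw, norm_smul, norm_smul, mul_pow, mul_pow,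
      Real.norm_eq_abs, sq_abs] at h2
    have : 0 ≤ t ^ 2 * ‖G w‖ ^ 2 := by positivity
    nlinarith
  set s := ⟪G u, G w⟫
  set C := ‖G‖ ^ 2 * ‖w‖ ^ 2
  have hC : 0 ≤ C := by positivity
  have h := key (s / (C + 1))
  have e1 : 2 * (s / (C + 1)) * s = 2 * s ^ 2 * (C + 1) / (C + 1) ^ 2 := by field_simp
  have e2 : (s / (C + 1)) ^ 2 * C = s ^ 2 * C / (C + 1) ^ 2 := by field_simp
  rw [e1, e2, div_le_div_iff_of_pos_right (by positivity)] at h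
  have : s ^ 2 ≤ 0 := by nlinarith [sq_nonneg s, mul_nonneg (sq_nonneg s) hC]
  nlinarith [sq_nonneg s, pow_eq_zero_iff (two_ne_zero) |>.1 (le_antisymm this (sq_nonneg s))]

theorem exists_top [FiniteDimensional ℝ V] [Nontrivial V] (G : V →L[ℝ] V) :
    ∃ u : V, ‖u‖ = 1 ∧ ‖G u‖ = ‖G‖ := by
  have hc : IsCompact (Metric.sphere (0 : V) 1) := isCompact_sphere 0 1
  have hne : (Metric.sphere (0 : V) 1).Nonempty := NormedSpace.sphere_nonempty.2 zero_le_one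
  obtain ⟨u, hu, hmax⟩ := hc.exists_isMaxOn hne (f := fun x => ‖G x‖) (by fun_prop)
  have hu1 : ‖u‖ = 1 := by simpa using hu
  refine ⟨u, hu1, le_antisymm ?_ ?_⟩
  · simpa [hu1] using G.le_opNorm u
  · refine G.opNorm_le_bound (norm_nonneg _) (fun x => ?_)
    by_cases hx : x = 0
    · simp [hx]
    have hx' : 0 < ‖x‖ := norm_pos_iff.2 hx
    have h1 : ‖G (‖x‖⁻¹ • x)‖ ≤ ‖G u‖ := hmax (by simp [norm_smul, hx'.ne'])
    rw [map_smul, norm_smul, norm_inv, norm_norm, inv_mul_le_iff₀ hx'] at h1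
    linarith

end helpers

set_option maxHeartbeats 1000000 in
/-- **Avalanche Principle, gap of the product.** -/
theorem avalanche_principle_gap :
    ∃ c > (0:ℝ), ∀ (m n : ℕ), 1 ≤ m → 1 ≤ n →
    ∀ ε κ : ℝ, 0 < ε → ε < 1 → 0 < κ → κ ≤ c * ε ^ 2 →
    ∀ g : ℕ → (EuclideanSpace ℝ (Fin m) →L[ℝ] EuclideanSpace ℝ (Fin m)),
    ∀ v : ℕ → EuclideanSpace ℝ (Fin m),
    (∀ i < n, g i ≠ 0) →
    (∀ i < n, ‖v i‖ = 1 ∧ ‖g i (v i)‖ = ‖g i‖ ∧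
      ∀ w, ⟪v i, w⟫ = 0 → ‖g i w‖ ≤ κ * ‖g i‖ * ‖w‖) →
    (∀ i, i + 1 < n → ε ≤ |⟪‖g i (v i)‖⁻¹ • (g i (v i)), v (i + 1)⟫|) →
    chainProd g n ≠ 0 ∧
    ∃ u : EuclideanSpace ℝ (Fin m), ‖u‖ = 1 ∧ ‖chainProd g n u‖ = ‖chainProd g n‖ ∧
      ∀ w, ⟪u, w⟫ = 0 →
        ‖chainProd g n w‖ ≤ (κ * (4 + 2 * ε) / ε ^ 2) ^ n * ‖chainProd g n‖ * ‖w‖ := by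
  refine ⟨1 / 16, by norm_num, ?_⟩
  intro m n hm hn ε κ hε hε1 hκ hk g v hg0 hg hang
  have hang' : ∀ i, i + 1 < n → ε * ‖g i‖ ≤ |⟪v (i + 1), g i (v i)⟫| := by
    intro i hi
    have h1 := hang i hi
    have hpos : 0 < ‖g i‖ := norm_pos_iff.2 (hg0 i (by omega))
    rw [(hg i (by omega)).2.1, real_inner_smul_left, abs_mul, abs_inv, abs_norm,
      le_inv_mul_iff₀ hpos, real_inner_comm] at h1
    linarith
  have cone : ∀ i < n, 3 / 4 * ε * ‖chainProd g i (v 0)‖ ≤ |⟪v i, chainProd g i (v 0)⟫| := by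
    intro i
    induction i with
    | zero =>
      intro h0
      have := (hg 0 h0).1
      simp only [chainProd, ContinuousLinearMap.id_apply, real_inner_self_eq_norm_sq, this]
      norm_num
      linarith
    | succ i ih =>
      intro hi
      obtain ⟨a1, a2, a3⟩ := hg i (by omega)
      exact step_cone (g i) (v i) (v (i + 1)) κ ε hκ hε hε1 hk a1 (hg (i + 1) hi).1 a2 a3
        (hang' i hi) _ (ih (by omega))
  have low : ∀ i ≤ n, (ε / 2) ^ i * (∏ j ∈ Finset.range i, ‖g j‖) ≤ ‖chainProd g i (v 0)‖ := by
    intro i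
    induction i with
    | zero =>
      intro _
      simp [chainProd, (hg 0 (by omega)).1]
    | succ i ih =>
      intro hi
      obtain ⟨a1, a2, a3⟩ := hg i (by omega)
      have h1 := step_norm (g i) (v i) κ ε hκ hε hε1 hk a1 a2 a3 _ (cone i (by omega))
      refine le_trans ?_ h1
      rw [Finset.prod_range_succ]
      calc _ = ε / 2 * ‖g i‖ * ((ε / 2) ^ i * (∏ j ∈ Finset.range i, ‖g j‖)) := by ring
        _ ≤ _ := by gcongr; exact ih (by omega)
  set P := ∏ j ∈ Finset.range n, ‖g j‖ with hP
  have hPpos : 0 < P := Finset.prod_pos fun j hj =>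
    norm_pos_iff.2 (hg0 j (Finset.mem_range.1 hj))
  have hlow := low n le_rfl
  rw [← hP] at hlow
  clear_value P
  have hGlow : (ε / 2) ^ n * P ≤ ‖chainProd g n‖ := by
    have h1 := (chainProd g n).le_opNorm (v 0)
    rw [(hg 0 (by omega)).1, mul_one] at h1
    exact hlow.trans h1
  have hlp : 0 < (ε / 2) ^ n * P := by positivity
  have hGpos : 0 < ‖chainProd g n‖ := hlp.trans_le hGlow
  refine ⟨norm_pos_iff.1 hGpos, ?_⟩
  haveI : Nonempty (Fin m) := ⟨⟨0, by omega⟩⟩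
  obtain ⟨u, hu, hGu⟩ := exists_top (chainProd g n)
  refine ⟨u, hu, hGu, fun w hw => ?_⟩
  have ho := top_orth _ u hu hGu w hw
  have hgr := gram2_chain g v κ hκ n (fun i hi => (hg i hi).2.2) u w
  unfold gram2 at hgr
  rw [ho, hw, hGu, hu, ← hP] at hgr
  generalize chainProd g n = G at *
  have h1 : ‖G‖ * ‖G w‖ ≤ κ ^ n * P ^ 2 * ‖w‖ := by
    apply le_of_sq_le_sq _ (by positivity)
    nlinarith
  have h2 : P ^ 2 ≤ ((4 + 2 * ε) / ε ^ 2) ^ n * ‖G‖ ^ 2 := by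
    calc P ^ 2 = (4 / ε ^ 2) ^ n * ((ε / 2) ^ n * P) ^ 2 := by
          rw [mul_pow, ← pow_mul, mul_comm n 2, pow_mul, ← mul_assoc, ← mul_pow]
          have : 4 / ε ^ 2 * (ε / 2) ^ 2 = 1 := by field_simp; norm_num
          rw [this]; simp
      _ ≤ _ := by gcongr; linarith
  have h3 : ‖G‖ * ‖G w‖ ≤ ‖G‖ * ((κ * (4 + 2 * ε) / ε ^ 2) ^ n * ‖G‖ * ‖w‖) := by
    calc _ ≤ _ := h1
      _ ≤ κ ^ n * (((4 + 2 * ε) / ε ^ 2) ^ n * ‖G‖ ^ 2) * ‖w‖ := by gcongr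
      _ = _ := by rw [mul_div_assoc, mul_pow]; ring
  exact le_of_mul_le_mul_left h3 hGpos
end
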